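/- arXiv:2010.14492 — 3 statements merged into one kernel-verified Lean document; each statement's English description precedes it below -/
import Mathlib

section
/- Let q be a prime power, F the finite field with q elements, and n ≥ 1 an integer. Let (A_i)_{i≥1} be an infinite sequence of linear codes over F with strictly increasing lengths N_i, where each A_i is a Cartesian product A_i = C_{i,1} × C_{i,2} × ⋯ × C_{i,ℓ_i} of linear codes, each constituent C_{i,j} being a linear [n_{i,j}, n_{i,j}-1] code over F of length n_{i,j} ≤ n. Then for any sequence (ω_i)_{i≥1} of nonnegative reals with liminf_i ω_i = ω, one has limsup_{i→∞} (1/N_i)·log_q( |A_i| / |A_i(ω_i)| ) ≤ R_0(ω,n). -/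
open Filter Set

noncomputable section

/-- `λ_q(ω,n)`. -/
def lambdaQ (q : ℕ) (ω : ℝ) (n : ℕ) : ℝ :=
  ⨅ z : Set.Ioc (0:ℝ) 1,
    (-ω * Real.logb q (z : ℝ) - 1 / n +
      (1 / n) * Real.logb q ((1 + ((q:ℝ) - 1) * (z:ℝ)) ^ n + ((q:ℝ) - 1) * (1 - (z:ℝ)) ^ n))

/-- `R_0(ω,n) = (n-1)/n - λ_q(ω,n)`. -/
def R0 (q : ℕ) (ω : ℝ) (n : ℕ) : ℝ := ((n:ℝ) - 1) / n - lambdaQ q ω n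

open Polynomial in
/-- The enumerator `∑_{c ∈ S} X^{w(c)}` of a weight function `w` on a finite set `S`. -/
def weightEnum {α : Type*} (S : Finset α) (w : α → ℕ) : Polynomial ℝ := ∑ c ∈ S, X ^ w c

open Polynomial in
/-- The Euler operator `X d/dX`. -/
def eulerOp (p : Polynomial ℝ) : Polynomial ℝ := X * derivative p

lemma eulerOp_mul (f g : Polynomial ℝ) :
    eulerOp (f * g) = eulerOp f * g + f * eulerOp g := by
  simp only [eulerOp, Polynomial.derivative_mul]; ring

lemma eulerOp_add (f g : Polynomial ℝ) : eulerOp (f + g) = eulerOp f + eulerOp g := by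
  simp only [eulerOp, Polynomial.derivative_add]; ring

section weightEnum

variable {α : Type*} (S : Finset α) (w : α → ℕ)

lemma eval_weightEnum (z : ℝ) : (weightEnum S w).eval z = ∑ c ∈ S, z ^ w c := by
  simp [weightEnum, Polynomial.eval_finsetSum]

lemma eulerOp_natCast_mul_X_pow (a k : ℕ) :
    eulerOp ((a : Polynomial ℝ) * Polynomial.X ^ k) = ((a * k : ℕ) : Polynomial ℝ) *
      Polynomial.X ^ k := by
  rcases k with _ | k
  · simp [eulerOp]
  · simp [eulerOp, Polynomial.derivative_mul]; ring

lemma eulerOp_sum (f : α → Polynomial ℝ) : eulerOp (∑ c ∈ S, f c) = ∑ c ∈ S, eulerOp (f c) := by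
  simp [eulerOp, Finset.mul_sum]

lemma eulerOp_weightEnum :
    eulerOp (weightEnum S w) = ∑ c ∈ S, (w c : Polynomial ℝ) * Polynomial.X ^ w c := by
  rw [weightEnum, eulerOp_sum]
  refine Finset.sum_congr rfl fun c _ => ?_
  simpa using eulerOp_natCast_mul_X_pow 1 (w c)

lemma eval_eulerOp_weightEnum (z : ℝ) :
    (eulerOp (weightEnum S w)).eval z = ∑ c ∈ S, w c * z ^ w c := by
  simp [eulerOp_weightEnum, Polynomial.eval_finsetSum]

lemma eval_eulerOp_eulerOp_weightEnum (z : ℝ) :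
    (eulerOp (eulerOp (weightEnum S w))).eval z = ∑ c ∈ S, (w c : ℝ) ^ 2 * z ^ w c := by
  simp [eulerOp_weightEnum, eulerOp_sum, eulerOp_natCast_mul_X_pow, Polynomial.eval_finsetSum, sq]

end weightEnum

/-- `VarBound p z V` says that the variance of the exponent, under the probability distribution
proportional to the terms of `p` evaluated at `z`, is at most `V`. -/
def VarBound (p : Polynomial ℝ) (z V : ℝ) : Prop :=
  p.eval z * (eulerOp (eulerOp p)).eval z - (eulerOp p).eval z ^ 2 ≤ V * p.eval z ^ 2

lemma VarBound.prod {ι : Type*} (s : Finset ι) (f : ι → Polynomial ℝ) (z : ℝ) (V : ι → ℝ)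
    (h : ∀ j ∈ s, VarBound (f j) z (V j)) : VarBound (∏ j ∈ s, f j) z (∑ j ∈ s, V j) := by
  classical
  induction s using Finset.induction_on with
  | empty => simp [VarBound, eulerOp]
  | insert a s ha ih =>
    rw [Finset.prod_insert ha, Finset.sum_insert ha]
    have h1 := h a (Finset.mem_insert_self a s)
    have h2 := ih fun j hj => h j (Finset.mem_insert_of_mem hj)
    unfold VarBound at *
    simp only [eulerOp_mul, eulerOp_add, Polynomial.eval_mul, Polynomial.eval_add]
    nlinarith [mul_le_mul_of_nonneg_right h1 (sq_nonneg ((∏ j ∈ s, f j).eval z)),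
      mul_le_mul_of_nonneg_right h2 (sq_nonneg ((f a).eval z))]

lemma varBound_weightEnum {α : Type*} (S : Finset α) (w : α → ℕ) {z : ℝ} (hz : 0 ≤ z) {d : ℕ}
    (hd : ∀ c ∈ S, w c ≤ d) : VarBound (weightEnum S w) z ((d : ℝ) ^ 2) := by
  unfold VarBound
  have h0 : 0 ≤ ∑ c ∈ S, z ^ w c := Finset.sum_nonneg fun c _ => by positivity
  have h2 : ∑ c ∈ S, (w c : ℝ) ^ 2 * z ^ w c ≤ (d : ℝ) ^ 2 * ∑ c ∈ S, z ^ w c := by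
    rw [Finset.mul_sum]
    refine Finset.sum_le_sum fun c hc => ?_
    have : (w c : ℝ) ≤ d := by exact_mod_cast hd c hc
    gcongr
  rw [eval_weightEnum, eval_eulerOp_weightEnum, eval_eulerOp_eulerOp_weightEnum]
  nlinarith [mul_le_mul_of_nonneg_left h2 h0, sq_nonneg (∑ c ∈ S, (w c : ℝ) * z ^ w c)]

/-- Chebyshev's inequality for the distribution proportional to `z ^ w c`. -/
lemma half_le_sum_near_mean {α : Type*} (S : Finset α) (w : α → ℕ) {z V t μ : ℝ} (hz : 0 ≤ z)
    (hS : 0 < (weightEnum S w).eval z) (hV : VarBound (weightEnum S w) z V) (ht : 0 < t)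
    (htV : 2 * V ≤ t ^ 2)
    (hμ : (eulerOp (weightEnum S w)).eval z = μ * (weightEnum S w).eval z) :
    (weightEnum S w).eval z / 2 ≤ ∑ c ∈ S with |(w c : ℝ) - μ| ≤ t, z ^ w c := by
  unfold VarBound at hV
  rw [eval_weightEnum] at *
  rw [eval_eulerOp_weightEnum] at *
  rw [eval_eulerOp_eulerOp_weightEnum, hμ] at hV
  set M := ∑ c ∈ S, z ^ w c with hM
  have hsplit := Finset.sum_filter_add_sum_filter_not S (fun c => |(w c : ℝ) - μ| ≤ t)
    (fun c => z ^ w c)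
  have hvar : ∑ c ∈ S, ((w c : ℝ) - μ) ^ 2 * z ^ w c
      = ∑ c ∈ S, (w c : ℝ) ^ 2 * z ^ w c - μ ^ 2 * M := by
    have : ∀ c ∈ S, ((w c : ℝ) - μ) ^ 2 * z ^ w c
        = (w c : ℝ) ^ 2 * z ^ w c - 2 * μ * (w c * z ^ w c) + μ ^ 2 * z ^ w c :=
      fun c _ => by ring
    rw [Finset.sum_congr rfl this, Finset.sum_add_distrib, Finset.sum_sub_distrib,
      ← Finset.mul_sum, ← Finset.mul_sum, hμ, ← hM]
    ring
  have hfar : t ^ 2 * ∑ c ∈ S with ¬ |(w c : ℝ) - μ| ≤ t, z ^ w c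
      ≤ ∑ c ∈ S, ((w c : ℝ) - μ) ^ 2 * z ^ w c := by
    rw [Finset.mul_sum]
    refine (Finset.sum_le_sum fun c hc => ?_).trans
      (Finset.sum_le_sum_of_subset_of_nonneg (Finset.filter_subset _ _)
        fun c _ _ => by positivity)
    have h := (Finset.mem_filter.1 hc).2
    have h' : t ^ 2 ≤ ((w c : ℝ) - μ) ^ 2 := by
      rw [← sq_abs ((w c : ℝ) - μ)]
      have := (not_le.1 h).le
      gcongr
    gcongr
  have hVM : ∑ c ∈ S, (w c : ℝ) ^ 2 * z ^ w c - μ ^ 2 * M ≤ V * M := by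
    refine le_of_mul_le_mul_left ?_ hS
    linarith
  have h3 : t ^ 2 * ∑ c ∈ S with ¬ |(w c : ℝ) - μ| ≤ t, z ^ w c ≤ t ^ 2 * (M / 2) := by
    nlinarith
  have h4 := le_of_mul_le_mul_left h3 (by positivity)
  linarith

/-- The function `log p(z) - b log z` on `(0, 1]` has a minimizer bounded away from `0`, at which
the tilted mean of the exponent is `b`, or at most `b` if the minimizer is `1`. -/
lemma exists_tilt {α : Type*} (S : Finset α) (w : α → ℕ) {b z₀ : ℝ} (hz₀ : 0 < z₀) (hz₁ : z₀ ≤ 1)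
    (hzero : ∃ c ∈ S, w c = 0) (hcard : Real.log S.card < -b * Real.log z₀) :
    ∃ z μ : ℝ, z₀ ≤ z ∧ z ≤ 1 ∧
      (eulerOp (weightEnum S w)).eval z = μ * (weightEnum S w).eval z ∧
      μ ≤ b ∧ (z = 1 ∨ μ = b) := by
  set F := weightEnum S w with hF
  have hFone : ∀ z, 0 < z → 1 ≤ F.eval z := by
    intro z hz
    obtain ⟨c, hc, hc0⟩ := hzero
    rw [hF, eval_weightEnum]
    have := Finset.single_le_sum (f := fun c => z ^ w c) (fun i _ => by positivity) hc
    simpa [hc0] using this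
  have hderiv : ∀ z, 0 < z → HasDerivAt (fun z => Real.log (F.eval z) - b * Real.log z)
      (F.derivative.eval z / F.eval z - b * z⁻¹) z := by
    intro z hz
    have h1 := (F.hasDerivAt z).log (by linarith [hFone z hz])
    exact h1.sub ((Real.hasDerivAt_log hz.ne').const_mul b)
  have hcont : ContinuousOn (fun z => Real.log (F.eval z) - b * Real.log z) (Icc z₀ 1) :=
    fun z hz => (hderiv z (hz₀.trans_le hz.1)).continuousAt.continuousWithinAt
  obtain ⟨z, hz, hmin⟩ := isCompact_Icc.exists_isMinOn (nonempty_Icc.2 hz₁) hcont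
  have hzpos : 0 < z := hz₀.trans_le hz.1
  have hFz := hFone z hzpos
  have hne : z ≠ z₀ := by
    rintro rfl
    have h1 := hmin (right_mem_Icc.2 hz₁)
    have hcard' : F.eval 1 = S.card := by simp [hF, eval_weightEnum]
    simp only [mem_ofPred_eq, hcard', Real.log_one, mul_zero, sub_zero] at h1
    have := Real.log_nonneg hFz
    linarith
  have hzlt : z₀ < z := lt_of_le_of_ne hz.1 hne.symm
  have hμ : (eulerOp F).eval z = ((eulerOp F).eval z / F.eval z) * F.eval z := by
    field_simp
  have hD : F.derivative.eval z / F.eval z - b * z⁻¹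
      = ((eulerOp F).eval z / F.eval z - b) * z⁻¹ := by
    simp only [eulerOp, Polynomial.eval_mul, Polynomial.eval_X]
    field_simp
  have hzinv : 0 < z⁻¹ := by positivity
  refine ⟨z, (eulerOp F).eval z / F.eval z, hz.1, hz.2, hμ, ?_⟩
  rcases hz.2.lt_or_eq with hlt | rfl
  · have h0 := (hmin.isLocalMin (Icc_mem_nhds hzlt hlt)).hasDerivAt_eq_zero (hderiv z hzpos)
    rw [hD, mul_eq_zero, or_iff_left hzinv.ne', sub_eq_zero] at h0
    exact ⟨h0.le, Or.inr h0⟩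
  · refine ⟨?_, Or.inl rfl⟩
    have hcone : z₀ - 1 ∈ posTangentConeAt (Icc z₀ 1) (1 : ℝ) :=
      sub_mem_posTangentConeAt_of_segment_subset
        ((convex_Icc z₀ 1).segment_subset (right_mem_Icc.2 hz₁) (left_mem_Icc.2 hz₁))
    have h0 := hmin.localize.hasFDerivWithinAt_nonneg
      (hderiv 1 one_pos).hasFDerivAt.hasFDerivWithinAt hcone
    rw [hD] at h0
    simp at h0
    nlinarith

/-- A lower bound on the number of elements of weight at most `b + t`. -/
lemma exists_eval_le_card_mul_rpow {α : Type*} (S : Finset α) (w : α → ℕ) {b z₀ V t : ℝ}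
    (hz₀ : 0 < z₀) (hz₁ : z₀ ≤ 1) (hzero : ∃ c ∈ S, w c = 0)
    (hcard : Real.log S.card < -b * Real.log z₀)
    (hV : ∀ z, 0 ≤ z → VarBound (weightEnum S w) z V) (ht : 0 < t) (htV : 2 * V ≤ t ^ 2) :
    ∃ z : ℝ, z₀ ≤ z ∧ z ≤ 1 ∧
      (weightEnum S w).eval z / 2 ≤ (S.filter fun c => (w c : ℝ) ≤ b + t).card * z ^ (b - t) := by
  obtain ⟨z, μ, hzl, hz1, hμ, hμb, hcase⟩ := exists_tilt S w hz₀ hz₁ hzero hcard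
  have hzpos : 0 < z := hz₀.trans_le hzl
  refine ⟨z, hzl, hz1, ?_⟩
  have hpos : 0 < (weightEnum S w).eval z := by
    rw [eval_weightEnum]
    obtain ⟨c, hc, -⟩ := hzero
    exact Finset.sum_pos (fun _ _ => by positivity) ⟨c, hc⟩
  refine (half_le_sum_near_mean S w hzpos.le hpos (hV z hzpos.le) ht htV hμ).trans ?_
  rw [← nsmul_eq_mul]
  have hsub : (S.filter fun c => |(w c : ℝ) - μ| ≤ t) ⊆ S.filter fun c => (w c : ℝ) ≤ b + t := by
    refine Finset.monotone_filter_right S fun c _ hc => ?_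
    have := (abs_le.1 hc).2
    linarith
  refine (Finset.sum_le_card_nsmul _ _ (z ^ (b - t)) fun c hc => ?_).trans
    (nsmul_le_nsmul_left (by positivity) (Finset.card_le_card hsub))
  rw [← Real.rpow_natCast]
  rcases hcase with rfl | rfl
  · simp
  · have := (abs_le.1 (Finset.mem_filter.1 hc).2).1
    exact Real.rpow_le_rpow_of_exponent_ge hzpos hz1 (by linarith)

lemma hammingNorm_eq_sum {ι K : Type*} [Fintype ι] [Zero K] [DecidableEq K] (c : ι → K) :
    hammingNorm c = ∑ t, if c t = 0 then 0 else 1 := by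
  simp [hammingNorm, Finset.card_filter]

lemma hammingNorm_sigma {ι K : Type*} [Fintype ι] {κ : ι → Type*} [∀ j, Fintype (κ j)] [Zero K]
    [DecidableEq K] (c : (Σ j, κ j) → K) :
    hammingNorm c = ∑ j, hammingNorm fun t => c ⟨j, t⟩ := by
  simp only [hammingNorm_eq_sum, Fintype.sum_sigma]

lemma pow_hammingNorm {ι K R : Type*} [Fintype ι] [Zero K] [DecidableEq K] [CommSemiring R]
    (z : R) (c : ι → K) : z ^ hammingNorm c = ∏ t, if c t = 0 then 1 else z := by
  rw [hammingNorm_eq_sum, ← Finset.prod_pow_eq_pow_sum]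
  exact Finset.prod_congr rfl fun t _ => by split_ifs <;> simp

/-- The weight enumerator of a Cartesian product of codes is the product of their enumerators. -/
lemma weightEnum_sigma {ι K : Type*} [Fintype ι] [DecidableEq ι] {κ : ι → Type*}
    [∀ j, Fintype (κ j)] [∀ j, DecidableEq (κ j)] [Zero K] [DecidableEq K] [Fintype K]
    (S : ∀ j, Finset (κ j → K)) :
    weightEnum (Finset.univ.filter fun x : (Σ j, κ j) → K => ∀ j, (fun t => x ⟨j, t⟩) ∈ S j)
      hammingNorm = ∏ j, weightEnum (S j) hammingNorm := by
  simp only [weightEnum]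
  rw [Finset.prod_univ_sum]
  refine Finset.sum_equiv (Equiv.piCurry fun _ _ => K) (fun x => ?_) (fun x _ => ?_)
  · simp only [Finset.mem_filter, Finset.mem_univ, true_and, Fintype.mem_piFinset]
    rfl
  · rw [hammingNorm_sigma, Finset.prod_pow_eq_pow_sum]
    rfl

/-- A code of codimension one is orthogonal to a single vector. -/
lemma exists_orthogonal_of_finrank {K : Type*} [Field K] {m : ℕ} (hm : 1 ≤ m) (C : Submodule K (Fin m → K))
    (hC : Module.finrank K C = m - 1) :
    ∃ y : Fin m → K, ∀ c, c ∈ C ↔ ∑ t, c t * y t = 0 := by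
  have hlt : C < ⊤ := by
    refine lt_top_iff_ne_top.2 fun h => ?_
    rw [h, finrank_top, Module.finrank_fin_fun] at hC
    omega
  obtain ⟨f, hf, hle⟩ := Submodule.exists_le_ker_of_lt_top C hlt
  have hker : Module.finrank K (LinearMap.ker f) = m - 1 := by
    have h1 := LinearMap.finrank_range_add_finrank_ker f
    rw [LinearMap.range_eq_top.2 (LinearMap.surjective hf), finrank_top, Module.finrank_self,
      Module.finrank_fin_fun] at h1
    omega
  have heq := Submodule.eq_of_le_of_finrank_eq hle (hC.trans hker.symm)
  refine ⟨fun t => f (Pi.single t 1), fun c => ?_⟩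
  rw [heq, LinearMap.mem_ker]
  have := LinearMap.pi_apply_eq_sum_univ f c
  rw [this]
  have e : ∀ t : Fin m, (Pi.single t 1 : Fin m → K) = fun j => if t = j then 1 else 0 := by
    intro t; ext j; simp [Pi.single_apply, eq_comm]
  simp [e]

lemma addChar_map_sum {A M ι : Type*} [AddCommMonoid A] [CommMonoid M] (ψ : AddChar A M)
    (s : Finset ι) (f : ι → A) : ψ (∑ i ∈ s, f i) = ∏ i ∈ s, ψ (f i) := by
  classical
  induction s using Finset.induction_on with
  | empty => simp
  | insert a s ha ih =>
    rw [Finset.sum_insert ha, Finset.prod_insert ha, AddChar.map_add_eq_mul, ih]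

section Hyperplane

variable {K : Type*} [Field K] [Fintype K] [DecidableEq K]

lemma sum_addChar_mul_weight {ψ : AddChar K ℂ} (hψ : ψ.IsPrimitive) (a : K) (z : ℂ) :
    ∑ x, ψ (x * a) * (if x = 0 then 1 else z)
      = if a = 0 then 1 + ((Fintype.card K : ℂ) - 1) * z else 1 - z := by
  have h : ∀ x, ψ (x * a) * (if x = 0 then 1 else z)
      = z * ψ (x * a) + if x = 0 then 1 - z else 0 := by
    intro x
    split_ifs with hx
    · simp [hx]
    · ring
  rw [Finset.sum_congr rfl fun x _ => h x, Finset.sum_add_distrib, ← Finset.mul_sum,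
    AddChar.sum_mulShift a hψ]
  simp only [Finset.sum_ite_eq', Finset.mem_univ, if_true]
  split_ifs <;> push_cast <;> ring

/-- The MacWilliams identity for the code orthogonal to a single vector. -/
lemma card_mul_sum_orthogonal {ι : Type*} [Fintype ι] [DecidableEq ι] (y : ι → K) (z : ℝ) :
    (Fintype.card K : ℝ) * ∑ c : ι → K with ∑ t, c t * y t = 0, z ^ hammingNorm c
      = (1 + ((Fintype.card K : ℝ) - 1) * z) ^ Fintype.card ι + ((Fintype.card K : ℝ) - 1) *
        ∏ t, if y t = 0 then 1 + ((Fintype.card K : ℝ) - 1) * z else 1 - z := by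
  have hψ := AddChar.FiniteField.primitiveChar_to_Complex_isPrimitive (F := K)
  set ψ := AddChar.FiniteField.primitiveChar_to_Complex K
  have key : ∑ b : K, ∑ c : ι → K, ψ (b * ∑ t, c t * y t) * (z : ℂ) ^ hammingNorm c
      = ∑ b : K, ∏ t, if b * y t = 0 then 1 + ((Fintype.card K : ℂ) - 1) * z else 1 - z := by
    refine Finset.sum_congr rfl fun b _ => ?_
    simp_rw [← sum_addChar_mul_weight hψ]
    rw [Finset.prod_univ_sum, Fintype.piFinset_univ]
    refine Finset.sum_congr rfl fun c _ => ?_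
    rw [Finset.prod_mul_distrib, pow_hammingNorm, Finset.mul_sum, addChar_map_sum]
    congr 1
    exact Finset.prod_congr rfl fun t _ => by congr 1; ring
  have lhs : ∑ b : K, ∑ c : ι → K, ψ (b * ∑ t, c t * y t) * (z : ℂ) ^ hammingNorm c
      = (Fintype.card K : ℂ) * ∑ c : ι → K with ∑ t, c t * y t = 0, (z : ℂ) ^ hammingNorm c := by
    rw [Finset.sum_comm, Finset.mul_sum, Finset.sum_filter]
    refine Finset.sum_congr rfl fun c _ => ?_
    rw [← Finset.sum_mul, AddChar.sum_mulShift _ hψ]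
    split_ifs <;> simp
  have rhs : ∑ b : K, ∏ t, (if b * y t = 0 then 1 + ((Fintype.card K : ℂ) - 1) * z else 1 - z)
      = (1 + ((Fintype.card K : ℂ) - 1) * z) ^ Fintype.card ι + ((Fintype.card K : ℂ) - 1) *
        ∏ t, if y t = 0 then 1 + ((Fintype.card K : ℂ) - 1) * z else 1 - z := by
    rw [← Finset.add_sum_erase _ _ (Finset.mem_univ (0 : K))]
    congr 1
    · simp
    · rw [Finset.sum_congr rfl (g := fun _ => ∏ t, if y t = 0 then
        1 + ((Fintype.card K : ℂ) - 1) * z else 1 - z)]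
      · rw [Finset.sum_const, Finset.card_erase_of_mem (Finset.mem_univ _), nsmul_eq_mul,
          Finset.card_univ, Nat.cast_sub Fintype.card_pos, Nat.cast_one]
      · intro b hb
        simp [Finset.ne_of_mem_erase hb]
  rw [lhs, rhs] at key
  apply_fun ((↑) : ℝ → ℂ) using Complex.ofReal_injective
  push_cast
  rw [key]
  congr 2
  refine Finset.prod_congr rfl fun t _ => ?_
  split_ifs <;> push_cast <;> rfl

lemma le_card_mul_eval_weightEnum {m : ℕ} (hm : 1 ≤ m) (C : Submodule K (Fin m → K))
    (hC : Module.finrank K C = m - 1) [DecidablePred (· ∈ C)] {z : ℝ} (hz0 : 0 ≤ z) (hz1 : z ≤ 1) :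
    (1 + ((Fintype.card K : ℝ) - 1) * z) ^ m + ((Fintype.card K : ℝ) - 1) * (1 - z) ^ m
      ≤ Fintype.card K * (weightEnum (Finset.univ.filter (· ∈ C)) hammingNorm).eval z := by
  obtain ⟨y, hy⟩ := exists_orthogonal_of_finrank hm C hC
  have hq : (1 : ℝ) ≤ Fintype.card K := by exact_mod_cast Fintype.card_pos
  have hg : 1 - z ≤ 1 + ((Fintype.card K : ℝ) - 1) * z := by nlinarith
  rw [eval_weightEnum]
  simp only [hy]
  rw [card_mul_sum_orthogonal, Fintype.card_fin]
  have hprod : (1 - z) ^ m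
      ≤ ∏ t, if y t = 0 then 1 + ((Fintype.card K : ℝ) - 1) * z else 1 - z := by
    have : (1 - z) ^ m = ∏ _t : Fin m, (1 - z) := by simp
    rw [this]
    refine Finset.prod_le_prod (fun _ _ => by linarith) fun t _ => ?_
    split_ifs
    · exact hg
    · exact le_rfl
  have hq' : (0 : ℝ) ≤ (Fintype.card K : ℝ) - 1 := by linarith
  gcongr

end Hyperplane

/-- Monotonicity in `m` of the normalized logarithm of `g ^ m + p * h ^ m`. -/
lemma mul_log_le_mul_log {g h p : ℝ} (hg : 0 < g) (hh : 0 ≤ h) (hgh : h ≤ g) (hp : 0 ≤ p)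
    {m n : ℕ} (hmn : m ≤ n) :
    m * Real.log (g ^ n + p * h ^ n) ≤ n * Real.log (g ^ m + p * h ^ m) := by
  have hr0 : 0 ≤ h / g := by positivity
  have hr1 : h / g ≤ 1 := (div_le_one hg).2 hgh
  have key : ∀ k : ℕ, Real.log (g ^ k + p * h ^ k)
      = k * Real.log g + Real.log (1 + p * (h / g) ^ k) := by
    intro k
    rw [← Real.log_pow, ← Real.log_mul (by positivity) (by positivity)]
    congr 1
    rw [div_pow]
    field_simp
  have h1 : Real.log (1 + p * (h / g) ^ n) ≤ Real.log (1 + p * (h / g) ^ m) := by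
    have := pow_le_pow_of_le_one hr0 hr1 hmn
    apply Real.log_le_log (by positivity)
    gcongr
  have h2 : 0 ≤ Real.log (1 + p * (h / g) ^ m) :=
    Real.log_nonneg (le_add_of_nonneg_right (by positivity))
  have hmn' : (m : ℝ) ≤ n := by exact_mod_cast hmn
  rw [key, key]
  nlinarith [mul_le_mul_of_nonneg_left h1 (Nat.cast_nonneg (α := ℝ) m),
    mul_le_mul_of_nonneg_right hmn' h2]

lemma bddBelow_lambdaQ {q : ℕ} (hq : 2 ≤ q) {ω : ℝ} (hω : 0 ≤ ω) (n : ℕ) :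
    BddBelow (range fun z : Set.Ioc (0:ℝ) 1 => (-ω * Real.logb q (z : ℝ) - 1 / n +
      (1 / n) * Real.logb q
        ((1 + ((q:ℝ) - 1) * (z:ℝ)) ^ n + ((q:ℝ) - 1) * (1 - (z:ℝ)) ^ n))) := by
  refine ⟨-(1 / n), ?_⟩
  rintro _ ⟨⟨z, hz0, hz1⟩, rfl⟩
  have hq' : (2 : ℝ) ≤ q := by exact_mod_cast hq
  have h1 : Real.logb q z ≤ 0 := Real.logb_nonpos (by linarith) hz0.le hz1
  have h2 : 0 ≤ Real.logb q ((1 + ((q:ℝ) - 1) * z) ^ n + ((q:ℝ) - 1) * (1 - z) ^ n) := by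
    refine Real.logb_nonneg (by linarith) ?_
    have h3 : 1 ≤ (1 + ((q:ℝ) - 1) * z) ^ n := one_le_pow₀ (by nlinarith)
    have h4 : 0 ≤ ((q:ℝ) - 1) * (1 - z) ^ n :=
      mul_nonneg (by linarith) (pow_nonneg (by linarith) n)
    linarith
  have h5 : 0 ≤ (1 / (n : ℝ)) * Real.logb q
      ((1 + ((q:ℝ) - 1) * z) ^ n + ((q:ℝ) - 1) * (1 - z) ^ n) := by positivity
  simp only
  nlinarith

lemma lambdaQ_le {q : ℕ} (hq : 2 ≤ q) {ω : ℝ} (hω : 0 ≤ ω) (n : ℕ) {z : ℝ} (hz0 : 0 < z)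
    (hz1 : z ≤ 1) :
    lambdaQ q ω n ≤ -ω * Real.logb q z - 1 / n + (1 / n) * Real.logb q
        ((1 + ((q:ℝ) - 1) * z) ^ n + ((q:ℝ) - 1) * (1 - z) ^ n) :=
  ciInf_le (bddBelow_lambdaQ hq hω n) (⟨z, hz0, hz1⟩ : Set.Ioc (0:ℝ) 1)

lemma lambdaQ_zero_nonpos {q : ℕ} (hq : 2 ≤ q) {n : ℕ} (hn : 1 ≤ n) : lambdaQ q 0 n ≤ 0 := by
  have hq' : (2 : ℝ) ≤ q := by exact_mod_cast hq
  have hn' : (1 : ℝ) ≤ n := by exact_mod_cast hn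
  let φ : ℝ → ℝ := fun z => - 1 / n + (1 / n) * Real.logb q
        ((1 + ((q:ℝ) - 1) * z) ^ n + ((q:ℝ) - 1) * (1 - z) ^ n)
  have hφ0 : φ 0 = 0 := by
    have : (q : ℝ) ≠ 0 := by linarith
    simp [φ, Real.logb_self_eq_one (show (1:ℝ) < q by linarith)]
    ring
  have hcont : ContinuousAt φ 0 := by
    refine continuousAt_const.add (continuousAt_const.mul ?_)
    refine ContinuousAt.logb (by fun_prop) ?_
    simp; linarith
  have htend : Tendsto φ (nhdsWithin 0 (Ioi 0)) (nhds 0) := by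
    have := hcont.tendsto.mono_left (nhdsWithin_le_nhds (s := Ioi (0:ℝ)))
    rwa [hφ0] at this
  refine ge_of_tendsto htend ?_
  filter_upwards [Ioc_mem_nhdsGT (zero_lt_one' ℝ)] with z hz
  refine (lambdaQ_le hq le_rfl n hz.1 hz.2).trans (le_of_eq ?_)
  simp only [φ]; ring

section ProductCode

variable {K : Type*} [Field K] [Fintype K] {ℓ : ℕ} {m : Fin ℓ → ℕ}

open Classical in
/-- The Cartesian product of the codes `C j`, as a finite set of words. -/
def productCode (C : ∀ j, Submodule K (Fin (m j) → K)) : Finset ((Σ j, Fin (m j)) → K) :=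
  Finset.univ.filter fun x => ∀ j, (fun t => x ⟨j, t⟩) ∈ C j

lemma zero_mem_productCode (C : ∀ j, Submodule K (Fin (m j) → K)) : 0 ∈ productCode C := by
  simp only [productCode, Finset.mem_filter, Finset.mem_univ, true_and]
  exact fun j => (C j).zero_mem

variable [DecidableEq K]

open Classical in
lemma weightEnum_productCode (C : ∀ j, Submodule K (Fin (m j) → K)) :
    weightEnum (productCode C) hammingNorm
      = ∏ j, weightEnum (Finset.univ.filter (· ∈ C j)) hammingNorm := by
  rw [← weightEnum_sigma]
  simp [productCode]

lemma logb_card_productCode (C : ∀ j, Submodule K (Fin (m j) → K)) (hm : ∀ j, 1 ≤ m j)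
    (hC : ∀ j, Module.finrank K (C j) = m j - 1) :
    Real.logb (Fintype.card K) (productCode C).card = (∑ j, (m j : ℝ)) - ℓ := by
  classical
  have hq : (1 : ℝ) < Fintype.card K := by exact_mod_cast Fintype.one_lt_card
  have h : ((productCode C).card : ℝ) = ∏ j, (Fintype.card K : ℝ) ^ (m j - 1) := by
    have h1 := congrArg (Polynomial.eval 1) (weightEnum_productCode C)
    rw [Polynomial.eval_prod] at h1
    simp only [eval_weightEnum, one_pow, Finset.sum_const, nsmul_eq_mul, mul_one] at h1
    rw [h1]
    refine Finset.prod_congr rfl fun j _ => ?_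
    rw [← hC j, ← Nat.cast_pow, ← Module.card_eq_pow_finrank (K := K) (V := C j),
      Fintype.card_subtype]
  rw [h, Finset.prod_pow_eq_pow_sum, Real.logb_pow, Real.logb_self_eq_one hq, mul_one,
    Nat.cast_sum, Finset.sum_congr rfl fun j _ => Nat.cast_sub (hm j)]
  simp

lemma le_logb_eval_weightEnum_productCode (C : ∀ j, Submodule K (Fin (m j) → K))
    (hm : ∀ j, 1 ≤ m j) (hC : ∀ j, Module.finrank K (C j) = m j - 1) {n : ℕ} (hn : 1 ≤ n)
    (hmn : ∀ j, m j ≤ n) {z : ℝ} (hz0 : 0 < z) (hz1 : z ≤ 1) :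
    (∑ j, (m j : ℝ)) * ((1 / n) * Real.logb (Fintype.card K)
        ((1 + ((Fintype.card K : ℝ) - 1) * z) ^ n + ((Fintype.card K : ℝ) - 1) * (1 - z) ^ n)) - ℓ
      ≤ Real.logb (Fintype.card K) ((weightEnum (productCode C) hammingNorm).eval z) := by
  classical
  have hq : (1 : ℝ) < Fintype.card K := by exact_mod_cast Fintype.one_lt_card
  have hn' : (0 : ℝ) < n := by exact_mod_cast hn
  have hlq : 0 < Real.log (Fintype.card K) := Real.log_pos hq
  set g : ℝ := 1 + ((Fintype.card K : ℝ) - 1) * z with hg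
  have hgpos : 0 < g := by nlinarith
  have hgz : 1 - z ≤ g := by nlinarith
  have hz1' : 0 ≤ 1 - z := by linarith
  have hp : 0 ≤ (Fintype.card K : ℝ) - 1 := by linarith
  have hL : ∀ k : ℕ, 0 < g ^ k + ((Fintype.card K : ℝ) - 1) * (1 - z) ^ k := fun k => by
    positivity
  have hle := fun j => le_card_mul_eval_weightEnum (hm j) (C j) (hC j) hz0.le hz1
  have hpos : ∀ j, 0 < (weightEnum (Finset.univ.filter (· ∈ C j)) hammingNorm).eval z :=
    fun j => pos_of_mul_pos_right ((hL (m j)).trans_le (hle j)) (by positivity)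
  rw [weightEnum_productCode, Polynomial.eval_prod, Real.logb_prod _ _ fun j _ => (hpos j).ne',
    Finset.sum_mul]
  have hℓ : (ℓ : ℝ) = ∑ _j : Fin ℓ, (1 : ℝ) := by simp
  rw [hℓ, ← Finset.sum_sub_distrib]
  refine Finset.sum_le_sum fun j _ => ?_
  have h1 := Real.logb_le_logb_of_le hq (hL (m j)) (hle j)
  rw [Real.logb_mul (by positivity) (hpos j).ne', Real.logb_self_eq_one hq] at h1
  have h2 := mul_log_le_mul_log hgpos hz1' hgz hp (hmn j)
  have h3 : (m j : ℝ) * ((1 / n) * Real.logb (Fintype.card K)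
        (g ^ n + ((Fintype.card K : ℝ) - 1) * (1 - z) ^ n))
      ≤ Real.logb (Fintype.card K) (g ^ m j + ((Fintype.card K : ℝ) - 1) * (1 - z) ^ m j) := by
    rw [Real.logb, Real.logb, le_div_iff₀ hlq]
    calc _ = (m j * Real.log (g ^ n + ((Fintype.card K : ℝ) - 1) * (1 - z) ^ n)) / n := by
          field_simp
      _ ≤ _ := by rw [div_le_iff₀ hn']; linarith
  linarith

lemma varBound_productCode (C : ∀ j, Submodule K (Fin (m j) → K)) {z : ℝ} (hz : 0 ≤ z) :
    VarBound (weightEnum (productCode C) hammingNorm) z (∑ j, (m j : ℝ) ^ 2) := by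
  classical
  rw [weightEnum_productCode]
  exact VarBound.prod _ _ _ _ fun j _ => varBound_weightEnum _ _ hz fun c _ => by
    simpa using hammingNorm_le_card_fintype (x := c)

/-- The rate of the words of relative weight at most `ω - δ` in a product code. -/
lemma logb_card_div_le (C : ∀ j, Submodule K (Fin (m j) → K))
    (hm : ∀ j, 1 ≤ m j) (hC : ∀ j, Module.finrank K (C j) = m j - 1) {n : ℕ} (hn : 1 ≤ n)
    (hmn : ∀ j, m j ≤ n) {ω δ N : ℝ} (hδ : 0 < δ) (hδω : 2 * δ < ω) (hN : N = ∑ j, (m j : ℝ))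
    (hNpos : 0 < N) (hNlarge : 2 * n ≤ δ ^ 2 * N) :
    Real.logb (Fintype.card K) ((productCode C).card /
        ((productCode C).filter fun c => (hammingNorm c : ℝ) ≤ (ω - δ) * N).card)
      ≤ N * (R0 (Fintype.card K) ω n + 3 * δ / (ω - 2 * δ)) + 1 := by
  have hq2 : 2 ≤ Fintype.card K := Fintype.one_lt_card
  have hq2' : (2 : ℝ) ≤ Fintype.card K := by exact_mod_cast hq2
  have hq : (1 : ℝ) < Fintype.card K := by linarith
  have hlq : 0 < Real.log (Fintype.card K) := Real.log_pos hq
  have ha : 0 < ω - 2 * δ := by linarith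
  have hcard := logb_card_productCode C hm hC
  rw [← hN] at hcard
  have hℓ : 0 < (ℓ : ℝ) := by
    rcases Nat.eq_zero_or_pos ℓ with rfl | h
    · simp [hN] at hNpos
    · exact_mod_cast h
  have hpow : (Fintype.card K : ℝ) ^ (-(1 / (ω - 2 * δ))) ≤ 1 :=
    Real.rpow_le_one_of_one_le_of_nonpos hq.le (by
      have : 0 < 1 / (ω - 2 * δ) := by positivity
      linarith)
  obtain ⟨z, hzl, hz1, hz⟩ := exists_eval_le_card_mul_rpow (productCode C) hammingNorm
    (b := (ω - 2 * δ) * N) (z₀ := (Fintype.card K : ℝ) ^ (-(1 / (ω - 2 * δ))))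
    (V := ∑ j, (m j : ℝ) ^ 2) (t := δ * N) (by positivity) hpow
    ⟨0, zero_mem_productCode C, by simp⟩ (by
      rw [Real.log_rpow (by linarith)]
      have h1 : Real.log (productCode C).card = (N - ℓ) * Real.log (Fintype.card K) := by
        rw [← hcard, Real.logb]; field_simp
      rw [h1]
      have h2 : -((ω - 2 * δ) * N) * (-(1 / (ω - 2 * δ)) * Real.log (Fintype.card K))
          = N * Real.log (Fintype.card K) := by field_simp
      rw [h2]
      nlinarith)
    (fun z hz => varBound_productCode C hz) (by positivity) (by
      have : ∑ j, (m j : ℝ) ^ 2 ≤ n * N := by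
        rw [hN, Finset.mul_sum]
        refine Finset.sum_le_sum fun j _ => ?_
        have : (m j : ℝ) ≤ n := by exact_mod_cast hmn j
        rw [sq]
        gcongr
      nlinarith)
  have hzpos : 0 < z := lt_of_lt_of_le (by positivity) hzl
  rw [show (ω - 2 * δ) * N + δ * N = (ω - δ) * N by ring,
    show (ω - 2 * δ) * N - δ * N = (ω - 3 * δ) * N by ring] at hz
  set P := productCode C
  set B := P.filter fun c => (hammingNorm c : ℝ) ≤ (ω - δ) * N with hB
  have hBpos : 0 < (B.card : ℝ) := by
    have : 0 ∈ B := Finset.mem_filter.2 ⟨zero_mem_productCode C, by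
      simp only [hammingNorm_zero, Nat.cast_zero]
      exact mul_nonneg (by linarith) hNpos.le⟩
    exact_mod_cast Finset.card_pos.2 ⟨0, this⟩
  have hPpos : 0 < (P.card : ℝ) := by
    exact_mod_cast Finset.card_pos.2 ⟨0, zero_mem_productCode C⟩
  have hFpos : 0 < (weightEnum P hammingNorm).eval z := by
    rw [eval_weightEnum]
    exact Finset.sum_pos (fun _ _ => by positivity) ⟨0, zero_mem_productCode C⟩
  have h1 := Real.logb_le_logb_of_le hq (by positivity) hz
  rw [Real.logb_div hFpos.ne' two_ne_zero, Real.logb_mul hBpos.ne' (by positivity),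
    Real.logb_rpow_eq_mul_logb_of_pos hzpos] at h1
  have h2 := le_logb_eval_weightEnum_productCode C hm hC hn hmn hzpos hz1
  rw [← hN] at h2
  have h3 := lambdaQ_le hq2 (show 0 ≤ ω by linarith) n hzpos hz1
  have h4 : Real.logb (Fintype.card K) 2 ≤ 1 := by
    rw [Real.logb_le_iff_le_rpow hq two_pos]; simpa using hq2'
  have h5 : -(1 / (ω - 2 * δ)) ≤ Real.logb (Fintype.card K) z := by
    rwa [Real.le_logb_iff_rpow_le hq hzpos]
  have h6 := mul_le_mul_of_nonneg_left h3 hNpos.le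
  have h7 := mul_le_mul_of_nonneg_left h5 (show 0 ≤ 3 * δ * N by positivity)
  have h8 : N * (R0 (Fintype.card K) ω n + 3 * δ / (ω - 2 * δ))
      = N - N * (1 / n) - N * lambdaQ (Fintype.card K) ω n + 3 * δ * N * (1 / (ω - 2 * δ)) := by
    have hn' : (n : ℝ) ≠ 0 := by positivity
    rw [R0]; field_simp
  rw [Real.logb_div hPpos.ne' hBpos.ne', hcard, h8]
  linarith

lemma logb_card_productCode_le (C : ∀ j, Submodule K (Fin (m j) → K))
    (hm : ∀ j, 1 ≤ m j) (hC : ∀ j, Module.finrank K (C j) = m j - 1) {n : ℕ} (hn : 1 ≤ n)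
    (hmn : ∀ j, m j ≤ n) :
    Real.logb (Fintype.card K) (productCode C).card
      ≤ (∑ j, (m j : ℝ)) * R0 (Fintype.card K) 0 n := by
  have hn' : (0 : ℝ) < n := by exact_mod_cast hn
  have hsum : ∑ j, (m j : ℝ) ≤ ℓ * n := by
    have := Finset.sum_le_sum fun (j : Fin ℓ) (_ : j ∈ Finset.univ) =>
      (Nat.cast_le (α := ℝ)).2 (hmn j)
    simpa using this
  have h1 : (∑ j, (m j : ℝ)) / n ≤ ℓ := (div_le_iff₀ hn').2 hsum
  have h2 := lambdaQ_zero_nonpos (q := Fintype.card K) Fintype.one_lt_card hn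
  have h0 : 0 ≤ ∑ j, (m j : ℝ) := by positivity
  rw [logb_card_productCode C hm hC, R0]
  have h3 : (∑ j, (m j : ℝ)) * (((n : ℝ) - 1) / n)
      = ∑ j, (m j : ℝ) - (∑ j, (m j : ℝ)) / n := by field_simp
  rw [mul_sub, h3]
  nlinarith

end ProductCode

/-- Proposition 3: if `(A_i)` is a sequence of linear codes over `F` of strictly
increasing lengths `N_i`, each a Cartesian product of linear `[n_{i,j}, n_{i,j}-1]`
codes of lengths `n_{i,j} ≤ n`, then for any nonnegative reals `ω_i` with
`liminf_i ω_i = ω`, one has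
`limsup_i (1/N_i)·log_q(|A_i| / |A_i(ω_i)|) ≤ R_0(ω,n)`. -/
theorem prop_R0
    (K : Type) [Field K] [Fintype K] [DecidableEq K]
    (q : ℕ) (hq : Fintype.card K = q)
    (n : ℕ) (hn : 1 ≤ n)
    -- the constituent codes: `ℓ i` of them in `A i`, of lengths `m i j`
    (ℓ : ℕ → ℕ) (m : ∀ i : ℕ, Fin (ℓ i) → ℕ)
    (hm1 : ∀ i j, 1 ≤ m i j) (hmn : ∀ i j, m i j ≤ n)
    (Cc : ∀ (i : ℕ) (j : Fin (ℓ i)), Submodule K (Fin (m i j) → K))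
    (hdim : ∀ i j, Module.finrank K (Cc i j) = m i j - 1)
    -- the lengths, strictly increasing
    (N : ℕ → ℕ) (hN : ∀ i, N i = ∑ j, m i j)
    (hmono : StrictMono N)
    -- `A i` is the Cartesian product of the constituent codes
    (A : ∀ i : ℕ, Set ((Σ j : Fin (ℓ i), Fin (m i j)) → K))
    (hA : ∀ i, A i = {x | ∀ j : Fin (ℓ i), (fun t => x ⟨j, t⟩) ∈ Cc i j})
    -- the weight fractions
    (ωs : ℕ → ℝ) (hωs : ∀ i, 0 ≤ ωs i)
    (ω : ℝ) (hω : liminf ωs atTop = ω) :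
    limsup (fun i =>
        Real.logb q (((A i).ncard : ℝ) /
          (({c ∈ A i | (hammingNorm c : ℝ) ≤ ωs i * (N i : ℝ)}).ncard : ℝ)) / (N i : ℝ))
      atTop ≤ R0 q ω n := by
  subst hq
  have hq2 : (2 : ℝ) ≤ Fintype.card K := by exact_mod_cast Fintype.one_lt_card
  have hq1 : (1 : ℝ) < Fintype.card K := by linarith
  have hA' : ∀ i, A i = productCode (Cc i) := fun i => by ext; simp [hA, productCode]
  have hN' : ∀ i, (N i : ℝ) = ∑ j, (m i j : ℝ) := fun i => by rw [hN]; push_cast; rfl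
  have hsub : ∀ i, {c ∈ A i | (hammingNorm c : ℝ) ≤ ωs i * (N i : ℝ)}
      = ((productCode (Cc i)).filter fun c => (hammingNorm c : ℝ) ≤ ωs i * (N i : ℝ) :
        Finset _) := fun i => by ext; simp [hA']
  simp only [hsub]
  simp only [hA', ncard_coe_finset]
  have hpos : ∀ i (x : ℝ), 0 ≤ x → 0 < (((productCode (Cc i)).filter
      fun c => (hammingNorm c : ℝ) ≤ x * (N i : ℝ)).card : ℝ) := fun i x hx => by
    have : 0 ∈ (productCode (Cc i)).filter fun c => (hammingNorm c : ℝ) ≤ x * (N i : ℝ) :=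
      Finset.mem_filter.2 ⟨zero_mem_productCode _, by
        simp only [hammingNorm_zero, Nat.cast_zero]; positivity⟩
    exact_mod_cast Finset.card_pos.2 ⟨0, this⟩
  have hPpos : ∀ i, 0 < ((productCode (Cc i)).card : ℝ) := fun i => by
    exact_mod_cast Finset.card_pos.2 ⟨0, zero_mem_productCode _⟩
  have hcob : IsCoboundedUnder (· ≤ ·) atTop (fun i =>
      Real.logb (Fintype.card K) (((productCode (Cc i)).card : ℝ) /
        (((productCode (Cc i)).filter fun c => (hammingNorm c : ℝ) ≤ ωs i * (N i : ℝ)).card : ℝ))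
          / (N i : ℝ)) := by
    refine isCoboundedUnder_le_of_le atTop (x := 0) fun i => ?_
    refine div_nonneg (Real.logb_nonneg hq1 ?_) (Nat.cast_nonneg _)
    rw [one_le_div (hpos i _ (hωs i))]
    exact_mod_cast Finset.card_filter_le _ _
  have hNtop : Tendsto (fun i => (N i : ℝ)) atTop atTop :=
    tendsto_natCast_atTop_atTop.comp hmono.tendsto_atTop
  have hω0 : 0 ≤ ω := by
    rw [← hω, liminf_eq]
    by_cases h : BddAbove {a | ∀ᶠ i in atTop, a ≤ ωs i}
    · exact le_csSup h (Eventually.of_forall hωs)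
    · rw [Real.sSup_of_not_bddAbove h]
  rcases hω0.eq_or_lt with h0 | hωpos
  · -- Here the bound is the trivial one; this covers the case where `ωs` tends to infinity.
    refine limsup_le_of_le hcob ?_
    filter_upwards [hNtop.eventually_gt_atTop 0] with i hi
    rw [← h0, div_le_iff₀ hi]
    refine le_trans ?_ ((logb_card_productCode_le (Cc i) (hm1 i) (hdim i) hn (hmn i)).trans_eq
      (by rw [hN', mul_comm]))
    refine Real.logb_le_logb_of_le hq1 (div_pos (hPpos i) (hpos i _ (hωs i))) ?_
    refine div_le_self (hPpos i).le ?_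
    exact_mod_cast hpos i _ (hωs i)
  · refine le_of_forall_pos_le_add fun ε hε => limsup_le_of_le hcob ?_
    obtain ⟨δ, hδ, hδ1, hδ2⟩ : ∃ δ : ℝ, 0 < δ ∧ δ ≤ ω / 4 ∧ δ ≤ ε * ω / 12 :=
      ⟨min (ω / 4) (ε * ω / 12), by positivity, min_le_left _ _, min_le_right _ _⟩
    have hlim : ∀ᶠ i in atTop, ω - δ < ωs i := by
      have hne : {a | ∀ᶠ i in atTop, a ≤ ωs i}.Nonempty := ⟨0, Eventually.of_forall hωs⟩
      rw [liminf_eq] at hω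
      obtain ⟨a, ha, hlt⟩ := exists_lt_of_lt_csSup hne (show ω - δ < _ by rw [hω]; linarith)
      filter_upwards [ha] with i hi using hlt.trans_le hi
    have hsmall : 3 * δ / (ω - 2 * δ) ≤ ε / 2 := by
      rw [div_le_iff₀ (by linarith)]
      nlinarith
    filter_upwards [hlim, hNtop.eventually_gt_atTop 0, hNtop.eventually_ge_atTop (2 * n / δ ^ 2),
      hNtop.eventually_ge_atTop (2 / ε)] with i hi hNi hNδ hNε
    rw [div_le_iff₀ hNi]
    rw [div_le_iff₀ (by positivity)] at hNδ hNε
    have hmain := logb_card_div_le (Cc i) (hm1 i) (hdim i) hn (hmn i) hδ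
      (show 2 * δ < ω by linarith) (hN' i) hNi (by linarith)
    have hB := hpos i (ω - δ) (by linarith)
    have hle : Real.logb (Fintype.card K) (((productCode (Cc i)).card : ℝ) /
        (((productCode (Cc i)).filter fun c => (hammingNorm c : ℝ) ≤ ωs i * (N i : ℝ)).card : ℝ))
        ≤ Real.logb (Fintype.card K) (((productCode (Cc i)).card : ℝ) /
        (((productCode (Cc i)).filter
          fun c => (hammingNorm c : ℝ) ≤ (ω - δ) * (N i : ℝ)).card : ℝ)) := by
      refine Real.logb_le_logb_of_le hq1 (div_pos (hPpos i) (hpos i _ (hωs i))) ?_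
      refine div_le_div_of_nonneg_left (hPpos i).le hB ?_
      refine Nat.cast_le.2 (Finset.card_le_card (Finset.monotone_filter_right _ fun c _ hc => ?_))
      exact le_trans hc (mul_le_mul_of_nonneg_right hi.le hNi.le)
    nlinarith [mul_le_mul_of_nonneg_left hsmall hNi.le]
end
end

section
/- Let X be a random variable taking values in a finite subset 𝒳 ⊂ ℝ with P(X = x) = p(x) > 0 for every x ∈ 𝒳, let x_min = min 𝒳, and let γ(u) = inf_{z∈(0,1]} z^{-u}·E[z^X]. Then the function u ↦ γ(u): (i) is identically 0 for u < x_min; (ii) satisfies γ(x_min) = p(x_min); (iii) is constantly 1 for u ≥ E[X]; (iv) is strictly increasing on x_min ≤ u < E[X]; (v) is continuous on (x_min, ∞) and right-continuous at x_min; and (vi) is log-concave on [x_min, ∞), i.e., u ↦ log γ(u) is concave there. -/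
open Filter Set

noncomputable section

/-- `γ(u) = inf_{z∈(0,1]} z^{-u}·E[z^X] = inf_{z∈(0,1]} Σ_{x∈𝒳} p(x)·z^{x-u}` for a
random variable `X` supported on the finite set `𝒳 ⊂ ℝ` with `P(X = x) = p x`. -/
def gammaFn (𝒳 : Finset ℝ) (p : ℝ → ℝ) (u : ℝ) : ℝ :=
  ⨅ z : Set.Ioc (0:ℝ) 1, ∑ x ∈ 𝒳, p x * (z : ℝ) ^ (x - u)

lemma gammaFn_bddBelow {𝒳 : Finset ℝ} {p : ℝ → ℝ} (hp : ∀ x ∈ 𝒳, 0 < p x) (u : ℝ) :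
    BddBelow (Set.range fun z : Set.Ioc (0:ℝ) 1 => ∑ x ∈ 𝒳, p x * (z : ℝ) ^ (x - u)) := by
  refine ⟨0, ?_⟩
  rintro _ ⟨z, rfl⟩
  exact Finset.sum_nonneg fun x hx =>
    mul_nonneg (hp x hx).le (Real.rpow_nonneg z.2.1.le _)

lemma gammaFn_le {𝒳 : Finset ℝ} {p : ℝ → ℝ} (hp : ∀ x ∈ 𝒳, 0 < p x) (u : ℝ) {z : ℝ}
    (hz0 : 0 < z) (hz1 : z ≤ 1) : gammaFn 𝒳 p u ≤ ∑ x ∈ 𝒳, p x * z ^ (x - u) :=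
  ciInf_le (gammaFn_bddBelow hp u) (⟨z, hz0, hz1⟩ : Set.Ioc (0:ℝ) 1)

lemma le_gammaFn {𝒳 : Finset ℝ} {p : ℝ → ℝ} {u c : ℝ}
    (h : ∀ z : ℝ, 0 < z → z ≤ 1 → c ≤ ∑ x ∈ 𝒳, p x * z ^ (x - u)) : c ≤ gammaFn 𝒳 p u := by
  have : Nonempty (Set.Ioc (0:ℝ) 1) := ⟨⟨1, one_pos, le_rfl⟩⟩
  exact le_ciInf fun z => h z z.2.1 z.2.2

lemma gammaFn_monotone {𝒳 : Finset ℝ} {p : ℝ → ℝ} (hp : ∀ x ∈ 𝒳, 0 < p x) :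
    Monotone (gammaFn 𝒳 p) := fun u v huv =>
  le_gammaFn fun _ hz0 hz1 => (gammaFn_le hp u hz0 hz1).trans <|
    Finset.sum_le_sum fun x hx => mul_le_mul_of_nonneg_left
      (Real.rpow_le_rpow_of_exponent_ge hz0 hz1 (by linarith)) (hp x hx).le

lemma tendsto_rpow_zero_right_of_pos {t : ℝ} (ht : 0 < t) :
    Tendsto (fun z : ℝ => z ^ t) (nhdsWithin 0 (Set.Ioi 0)) (nhds 0) := by
  have h := (Real.continuousAt_rpow_const 0 t (Or.inr ht.le)).tendsto
  rw [Real.zero_rpow ht.ne'] at h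
  exact h.mono_left nhdsWithin_le_nhds

/-- A limit of the defining sum as `z → 0⁺` bounds the infimum. -/
lemma gammaFn_le_of_tendsto {𝒳 : Finset ℝ} {p : ℝ → ℝ} (hp : ∀ x ∈ 𝒳, 0 < p x) {u c : ℝ}
    (h : Tendsto (fun z : ℝ => ∑ x ∈ 𝒳, p x * z ^ (x - u)) (nhdsWithin 0 (Set.Ioi 0))
      (nhds c)) : gammaFn 𝒳 p u ≤ c := by
  refine ge_of_tendsto h ?_
  filter_upwards [Ioc_mem_nhdsGT (zero_lt_one' ℝ)] with z hz
  exact gammaFn_le hp u hz.1 hz.2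

lemma gammaFn_eq_zero {𝒳 : Finset ℝ} {p : ℝ → ℝ} (hp : ∀ x ∈ 𝒳, 0 < p x) {u : ℝ}
    (hu : ∀ x ∈ 𝒳, u < x) : gammaFn 𝒳 p u = 0 := by
  refine le_antisymm (gammaFn_le_of_tendsto hp ?_) (le_gammaFn fun z hz0 _ =>
    Finset.sum_nonneg fun x hx => mul_nonneg (hp x hx).le (Real.rpow_nonneg hz0.le _))
  simpa using tendsto_finsetSum 𝒳 fun x hx =>
    (tendsto_rpow_zero_right_of_pos (sub_pos.2 (hu x hx))).const_mul (p x)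

lemma le_gammaFn_of_mem {𝒳 : Finset ℝ} {p : ℝ → ℝ} (hp : ∀ x ∈ 𝒳, 0 < p x) {m u : ℝ}
    (hm : m ∈ 𝒳) (hu : m ≤ u) : p m ≤ gammaFn 𝒳 p u :=
  le_gammaFn fun z hz0 hz1 => calc
    p m ≤ p m * z ^ (m - u) := le_mul_of_one_le_right (hp m hm).le
      (Real.one_le_rpow_of_pos_of_le_one_of_nonpos hz0 hz1 (by linarith))
    _ ≤ _ := Finset.single_le_sum (f := fun x => p x * z ^ (x - u))
      (fun x hx => mul_nonneg (hp x hx).le (Real.rpow_nonneg hz0.le _)) hm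

lemma gammaFn_min {𝒳 : Finset ℝ} {p : ℝ → ℝ} (hp : ∀ x ∈ 𝒳, 0 < p x) {m : ℝ}
    (hm : m ∈ 𝒳) (hmin : ∀ x ∈ 𝒳, m ≤ x) : gammaFn 𝒳 p m = p m := by
  refine le_antisymm (gammaFn_le_of_tendsto hp ?_) (le_gammaFn_of_mem hp hm le_rfl)
  have hsum : ∑ x ∈ 𝒳, (if x = m then p x else 0) = p m := by simp [hm]
  rw [← hsum]
  refine tendsto_finsetSum _ fun x hx => ?_
  split_ifs with hxm
  · simp [hxm]
  · simpa using (tendsto_rpow_zero_right_of_pos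
      (sub_pos.2 (lt_of_le_of_ne (hmin x hx) (Ne.symm hxm)))).const_mul (p x)

lemma gammaFn_le_one {𝒳 : Finset ℝ} {p : ℝ → ℝ} (hp : ∀ x ∈ 𝒳, 0 < p x)
    (hsum : ∑ x ∈ 𝒳, p x = 1) (u : ℝ) : gammaFn 𝒳 p u ≤ 1 := by
  simpa [hsum] using gammaFn_le hp u one_pos le_rfl

lemma gammaFn_eq_one {𝒳 : Finset ℝ} {p : ℝ → ℝ} (hp : ∀ x ∈ 𝒳, 0 < p x)
    (hsum : ∑ x ∈ 𝒳, p x = 1) {u : ℝ} (hu : ∑ x ∈ 𝒳, p x * x ≤ u) :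
    gammaFn 𝒳 p u = 1 := by
  refine le_antisymm (gammaFn_le_one hp hsum u) (le_gammaFn fun z hz0 hz1 => ?_)
  calc (1 : ℝ) ≤ 1 + Real.log z * (∑ x ∈ 𝒳, p x * x - u) := by
        nlinarith [Real.log_nonpos hz0.le hz1]
    _ = ∑ x ∈ 𝒳, p x * (Real.log z * (x - u) + 1) := by
        have : ∀ x, p x * (Real.log z * (x - u) + 1)
            = Real.log z * (p x * x) + (1 - Real.log z * u) * p x := fun x => by ring
        simp only [this, Finset.sum_add_distrib, ← Finset.mul_sum, hsum]
        ring
    _ ≤ ∑ x ∈ 𝒳, p x * z ^ (x - u) := Finset.sum_le_sum fun x hx => by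
        rw [Real.rpow_def_of_pos hz0]
        exact mul_le_mul_of_nonneg_left (Real.add_one_le_exp _) (hp x hx).le

lemma gammaFn_lt_one {𝒳 : Finset ℝ} {p : ℝ → ℝ} (hp : ∀ x ∈ 𝒳, 0 < p x)
    (hsum : ∑ x ∈ 𝒳, p x = 1) {u : ℝ} (hu : u < ∑ x ∈ 𝒳, p x * x) :
    gammaFn 𝒳 p u < 1 := by
  have hd : HasDerivAt (fun z : ℝ => ∑ x ∈ 𝒳, p x * z ^ (x - u))
      (∑ x ∈ 𝒳, p x * (x - u)) 1 := by
    refine HasDerivAt.fun_sum fun x _ => ?_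
    simpa using (Real.hasDerivAt_rpow_const (p := x - u)
      (Or.inl (one_ne_zero' ℝ))).const_mul (p x)
  have hpos : 0 < ∑ x ∈ 𝒳, p x * (x - u) := by
    simp only [mul_sub, Finset.sum_sub_distrib, ← Finset.sum_mul, hsum]
    linarith
  have hev := (hasDerivAt_iff_tendsto_slope_left_right.1 hd).1.eventually (lt_mem_nhds hpos)
  obtain ⟨z, hz, hz0, hz1⟩ := (hev.and (Ioo_mem_nhdsLT (zero_lt_one' ℝ))).exists
  refine (gammaFn_le hp u hz0 hz1.le).trans_lt ?_
  have h := (slope_pos_iff_gt hz1).1 hz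
  simpa [hsum] using h

lemma concaveOn_log_gammaFn {𝒳 : Finset ℝ} {p : ℝ → ℝ} (hp : ∀ x ∈ 𝒳, 0 < p x) {m : ℝ}
    (hm : m ∈ 𝒳) : ConcaveOn ℝ (Set.Ici m) (fun u => Real.log (gammaFn 𝒳 p u)) := by
  refine ⟨convex_Ici m, fun u hu v hv a b ha hb hab => ?_⟩
  have hγ : ∀ w ∈ Set.Ici m, 0 < gammaFn 𝒳 p w := fun w hw =>
    (hp m hm).trans_le (le_gammaFn_of_mem hp hm hw)
  have hw := convex_Ici m hu hv ha hb hab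
  simp only [smul_eq_mul] at hw ⊢
  rw [Real.le_log_iff_exp_le (hγ _ hw)]
  refine le_gammaFn fun z hz0 hz1 => ?_
  have hS : 0 < ∑ x ∈ 𝒳, p x * z ^ x := Finset.sum_pos
    (fun x hx => mul_pos (hp x hx) (Real.rpow_pos_of_pos hz0 _)) ⟨m, hm⟩
  have hfac : ∀ w, ∑ x ∈ 𝒳, p x * z ^ (x - w)
      = Real.exp (Real.log (∑ x ∈ 𝒳, p x * z ^ x) - w * Real.log z) := fun w => by
    rw [Real.exp_sub, Real.exp_log hS, mul_comm w, ← Real.rpow_def_of_pos hz0, Finset.sum_div]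
    exact Finset.sum_congr rfl fun x _ => by rw [Real.rpow_sub hz0, mul_div_assoc]
  have hlog : ∀ w ∈ Set.Ici m, Real.log (gammaFn 𝒳 p w)
      ≤ Real.log (∑ x ∈ 𝒳, p x * z ^ x) - w * Real.log z := fun w hw => by
    rw [Real.log_le_iff_le_exp (hγ w hw), ← hfac]
    exact gammaFn_le hp w hz0 hz1
  rw [hfac, Real.exp_le_exp]
  calc _ ≤ a * (Real.log (∑ x ∈ 𝒳, p x * z ^ x) - u * Real.log z)
        + b * (Real.log (∑ x ∈ 𝒳, p x * z ^ x) - v * Real.log z) :=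
        add_le_add (mul_le_mul_of_nonneg_left (hlog u hu) ha)
          (mul_le_mul_of_nonneg_left (hlog v hv) hb)
    _ = (a + b) * Real.log (∑ x ∈ 𝒳, p x * z ^ x) - (a * u + b * v) * Real.log z := by ring
    _ = _ := by rw [hab, one_mul]

lemma continuousOn_gammaFn {𝒳 : Finset ℝ} {p : ℝ → ℝ} (hp : ∀ x ∈ 𝒳, 0 < p x) {m : ℝ}
    (hm : m ∈ 𝒳) : ContinuousOn (gammaFn 𝒳 p) (Set.Ioi m) := by
  have h := (concaveOn_log_gammaFn hp hm).continuousOn_interior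
  rw [interior_Ici] at h
  refine h.rexp.congr fun u hu => ?_
  exact (Real.exp_log ((hp m hm).trans_le (le_gammaFn_of_mem hp hm (le_of_lt hu)))).symm

lemma continuousWithinAt_gammaFn_Ici {𝒳 : Finset ℝ} {p : ℝ → ℝ} (hp : ∀ x ∈ 𝒳, 0 < p x)
    (u : ℝ) : ContinuousWithinAt (gammaFn 𝒳 p) (Set.Ici u) u := by
  refine tendsto_order.2 ⟨fun c hc => ?_, fun c hc => ?_⟩
  · filter_upwards [self_mem_nhdsWithin] with v hv
    exact hc.trans_le (gammaFn_monotone hp hv)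
  · have : Nonempty (Set.Ioc (0:ℝ) 1) := ⟨⟨1, one_pos, le_rfl⟩⟩
    obtain ⟨⟨z, hz0, hz1⟩, hz⟩ := exists_lt_of_ciInf_lt hc
    have hcont : Continuous fun v : ℝ => ∑ x ∈ 𝒳, p x * z ^ (x - v) :=
      continuous_finsetSum _ fun x _ => continuous_const.mul
        (continuous_const.rpow (continuous_const.sub continuous_id) fun _ => Or.inl hz0.ne')
    filter_upwards [nhdsWithin_le_nhds (hcont.continuousAt.eventually (gt_mem_nhds hz))]
      with v hv
    exact (gammaFn_le hp v hz0 hz1).trans_lt hv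

lemma strictMonoOn_gammaFn {𝒳 : Finset ℝ} {p : ℝ → ℝ} (hp : ∀ x ∈ 𝒳, 0 < p x)
    (hsum : ∑ x ∈ 𝒳, p x = 1) {m : ℝ} (hm : m ∈ 𝒳) :
    StrictMonoOn (gammaFn 𝒳 p) (Set.Ico m (∑ x ∈ 𝒳, p x * x)) := by
  intro u hu v hv huv
  have hγ : ∀ w, m ≤ w → 0 < gammaFn 𝒳 p w := fun w hw =>
    (hp m hm).trans_le (le_gammaFn_of_mem hp hm hw)
  refine (Real.log_lt_log_iff (hγ u hu.1) (hγ v hv.1)).1 ?_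
  refine (concaveOn_log_gammaFn hp hm).left_lt_of_lt_right (x := u)
    (y := ∑ x ∈ 𝒳, p x * x) (z := v) hu.1 (hv.1.trans hv.2.le) ?_ ?_
  · rw [openSegment_eq_Ioo (huv.trans hv.2)]
    exact ⟨huv, hv.2⟩
  · simp only [gammaFn_eq_one hp hsum le_rfl, Real.log_one]
    exact Real.log_neg (hγ v hv.1) (gammaFn_lt_one hp hsum hv.2)

/-- Properties of `u ↦ γ(u)`: it vanishes for `u < x_min`, equals `p(x_min)` at
`u = x_min`, is constantly `1` for `u ≥ E[X]`, is strictly increasing on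
`[x_min, E[X])`, is continuous on `(x_min, ∞)` and right-continuous at `x_min`,
and is log-concave on `[x_min, ∞)`. -/
theorem gamma_properties
    (𝒳 : Finset ℝ) (h𝒳 : 𝒳.Nonempty)
    (p : ℝ → ℝ) (hp : ∀ x ∈ 𝒳, 0 < p x) (hsum : ∑ x ∈ 𝒳, p x = 1)
    (xmin : ℝ) (hxmin : xmin = 𝒳.min' h𝒳)
    (EX : ℝ) (hEX : EX = ∑ x ∈ 𝒳, p x * x) :
    -- (i) identically zero below `x_min`
    (∀ u : ℝ, u < xmin → gammaFn 𝒳 p u = 0) ∧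
    -- (ii) value `p(x_min)` at `u = x_min`
    gammaFn 𝒳 p xmin = p xmin ∧
    -- (iii) constantly `1` for `u ≥ E[X]`
    (∀ u : ℝ, EX ≤ u → gammaFn 𝒳 p u = 1) ∧
    -- (iv) strictly increasing on `x_min ≤ u < E[X]`
    StrictMonoOn (gammaFn 𝒳 p) (Set.Ico xmin EX) ∧
    -- (v) continuous on `(x_min, ∞)` and right-continuous at `x_min`
    ContinuousOn (gammaFn 𝒳 p) (Set.Ioi xmin) ∧
    ContinuousWithinAt (gammaFn 𝒳 p) (Set.Ici xmin) xmin ∧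
    -- (vi) log-concave on `[x_min, ∞)`
    ConcaveOn ℝ (Set.Ici xmin) (fun u => Real.log (gammaFn 𝒳 p u)) := by
  subst hxmin hEX
  have hm := 𝒳.min'_mem h𝒳
  have hmin : ∀ x ∈ 𝒳, 𝒳.min' h𝒳 ≤ x := fun x hx => 𝒳.min'_le x hx
  exact ⟨fun u hu => gammaFn_eq_zero hp fun x hx => hu.trans_le (hmin x hx),
    gammaFn_min hp hm hmin, fun u hu => gammaFn_eq_one hp hsum hu,
    strictMonoOn_gammaFn hp hsum hm, continuousOn_gammaFn hp hm,
    continuousWithinAt_gammaFn_Ici hp _, concaveOn_log_gammaFn hp hm⟩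
end
end

section
/- Let q be a prime power and F the finite field with q elements (more generally, a finite Abelian group of size q). For every fixed δ ∈ [0,(q-1)/q], the mapping ω ↦ R_opt(δ,ω) is non-decreasing on the interval ω ∈ [0,(q-1)/q]. -/
open Filter Set

noncomputable section

/-- Minimum (Hamming) distance of a code. -/
def minDist {K : Type} [DecidableEq K] {ι : Type} [Fintype ι] (C : Set (ι → K)) : ℕ :=
  sInf {d : ℕ | ∃ c ∈ C, ∃ c' ∈ C, c ≠ c' ∧ hammingDist c c' = d}

/-- `R_opt(δ,ω)`: the supremum of rates of infinite sequences of constant-weight codes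
over `K` with relative minimum distance at least `δ` and relative codeword weight
tending to `ω`. -/
def RoptCW (K : Type) [Field K] [Fintype K] [DecidableEq K] (q : ℕ) (δ ω : ℝ) : ℝ :=
  sSup {R : ℝ | ∃ (N : ℕ → ℕ) (C : ∀ i : ℕ, Set (Fin (N i) → K)) (w : ℕ → ℕ),
    StrictMono N ∧ (∀ i, (C i).Nonempty) ∧
    (∀ i, ∀ c ∈ C i, hammingNorm c = w i) ∧
    Tendsto (fun i => (w i : ℝ) / (N i : ℝ)) atTop (nhds ω) ∧
    δ ≤ liminf (fun i => (minDist (C i) : ℝ) / (N i : ℝ)) atTop ∧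
    R = limsup (fun i => Real.logb q ((C i).ncard : ℝ) / (N i : ℝ)) atTop}
/-- The mixture of a point mass at `0` (weight `1 - β`) and the uniform distribution on `K`
(weight `β`). -/
def mixPMF (K : Type) [Field K] [Fintype K] [DecidableEq K] (β : ℝ) (x : K) : ℝ :=
  (1 - β) * (if x = 0 then 1 else 0) + β / Fintype.card K

lemma sum_mixPMF_mul (K : Type) [Field K] [Fintype K] [DecidableEq K] (β : ℝ) (g : K → ℝ) :
    ∑ x, mixPMF K β x * g x = (1 - β) * g 0 + β / Fintype.card K * ∑ x, g x := by
  simp only [mixPMF, add_mul, Finset.sum_add_distrib, Finset.mul_sum]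
  simp

lemma sum_mixPMF (K : Type) [Field K] [Fintype K] [DecidableEq K] (β : ℝ) :
    ∑ x, mixPMF K β x = 1 := by
  have h := sum_mixPMF_mul K β (fun _ => 1)
  simp only [mul_one] at h
  rw [h]
  simp

lemma mixPMF_nonneg (K : Type) [Field K] [Fintype K] [DecidableEq K] {β : ℝ}
    (h0 : 0 ≤ β) (h1 : β ≤ 1) (x : K) : 0 ≤ mixPMF K β x := by
  unfold mixPMF
  have : 0 ≤ 1 - β := by linarith
  split_ifs <;> positivity

lemma sum_prod_eq_one {K : Type} [Fintype K] (p : K → ℝ) (hp : ∑ x, p x = 1) (n : ℕ) :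
    ∑ v : Fin n → K, ∏ j, p (v j) = 1 := by
  classical
  rw [← Fintype.piFinset_univ, ← Finset.prod_univ_sum (fun _ => Finset.univ) (fun _ x => p x)]
  simp [hp]

/-- A sum of independent centred variables is centred, with variance the sum of variances. -/
lemma moments_sum_pi {K : Type} [Fintype K] (p : K → ℝ)
    (hp : ∑ x, p x = 1) (n : ℕ) (f : Fin n → K → ℝ)
    (hf : ∀ j, ∑ x, p x * f j x = 0) :
    ∑ v : Fin n → K, (∏ j, p (v j)) * ∑ j, f j (v j) = 0 ∧
    ∑ v : Fin n → K, (∏ j, p (v j)) * (∑ j, f j (v j)) ^ 2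
      = ∑ j, ∑ x, p x * f j x ^ 2 := by
  induction n with
  | zero => simp
  | succ n ih =>
    obtain ⟨h1, h2⟩ := ih (fun j => f j.succ) (fun j => hf j.succ)
    have h0 := sum_prod_eq_one p hp n
    constructor
    · rw [← (Fin.consEquiv (fun _ => K)).sum_comp, Fintype.sum_prod_type]
      simp only [Fin.consEquiv_apply, Fin.prod_univ_succ, Fin.sum_univ_succ, Fin.cons_zero,
        Fin.cons_succ]
      have (x : K) : ∑ v : Fin n → K, p x * (∏ j, p (v j)) * (f 0 x + ∑ j, f j.succ (v j))
          = p x * f 0 x := by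
        calc _ = p x * f 0 x * ∑ v : Fin n → K, (∏ j, p (v j))
            + p x * ∑ v : Fin n → K, (∏ j, p (v j)) * ∑ j, f j.succ (v j) := by
              rw [Finset.mul_sum, Finset.mul_sum, ← Finset.sum_add_distrib]
              exact Finset.sum_congr rfl fun v _ => by ring
          _ = _ := by rw [h0, h1]; ring
      simp only [this, hf]
    · rw [← (Fin.consEquiv (fun _ => K)).sum_comp, Fintype.sum_prod_type]
      simp only [Fin.consEquiv_apply, Fin.prod_univ_succ, Fin.sum_univ_succ, Fin.cons_zero,
        Fin.cons_succ]
      have (x : K) : ∑ v : Fin n → K,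
          p x * (∏ j, p (v j)) * (f 0 x + ∑ j, f j.succ (v j)) ^ 2
          = p x * f 0 x ^ 2 + p x * ∑ j : Fin n, ∑ x, p x * f j.succ x ^ 2 := by
        calc _ = p x * f 0 x ^ 2 * ∑ v : Fin n → K, (∏ j, p (v j))
            + 2 * p x * f 0 x * ∑ v : Fin n → K, (∏ j, p (v j)) * ∑ j, f j.succ (v j)
            + p x * ∑ v : Fin n → K, (∏ j, p (v j)) * (∑ j, f j.succ (v j)) ^ 2 := by
              simp only [Finset.mul_sum (s := (Finset.univ : Finset (Fin n → K))),
                ← Finset.sum_add_distrib]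
              exact Finset.sum_congr rfl fun v _ => by ring
          _ = _ := by rw [h0, h1, h2]; ring
      simp only [this, Finset.sum_add_distrib, ← Finset.sum_mul, hp, one_mul]

lemma hammingNorm_cast {K : Type} [Field K] [DecidableEq K] {n : ℕ} (c : Fin n → K) :
    (hammingNorm c : ℝ) = ∑ j, if c j = 0 then (0 : ℝ) else 1 := by
  have (j : Fin n) : (if c j = 0 then (0 : ℝ) else 1) = if c j ≠ 0 then 1 else 0 := by
    split_ifs <;> simp_all
  simp only [this, hammingNorm, Finset.sum_boole]

/-- The weight of a word shifted by a random vector has variance at most the length. -/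
lemma variance_hammingNorm_add_le (K : Type) [Field K] [Fintype K] [DecidableEq K]
    {β : ℝ} (h0 : 0 ≤ β) (h1 : β ≤ 1) {n : ℕ} (c : Fin n → K) :
    ∑ v : Fin n → K, (∏ j, mixPMF K β (v j)) * ((hammingNorm (c + v) : ℝ) -
      ((1 - β) * hammingNorm c
        + β * (((Fintype.card K : ℝ) - 1) / Fintype.card K) * n)) ^ 2 ≤ (n : ℝ) := by
  have hq : (1 : ℝ) ≤ Fintype.card K := by exact_mod_cast Fintype.card_pos (α := K)
  have hq0 : (Fintype.card K : ℝ) ≠ 0 := by positivity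
  set κ : ℝ := ((Fintype.card K : ℝ) - 1) / Fintype.card K with hκ
  have hκ0 : 0 ≤ κ := div_nonneg (by linarith) (by linarith)
  have hκ1 : κ ≤ 1 := by rw [hκ, div_le_one (by linarith)]; linarith
  set m : Fin n → ℝ := fun j => (1 - β) * (if c j = 0 then 0 else 1) + β * κ with hm
  set f : Fin n → K → ℝ := fun j x => (if c j + x = 0 then 0 else 1) - m j with hf
  have hmem (j : Fin n) : 0 ≤ m j ∧ m j ≤ 1 := by
    have a : 0 ≤ β * κ := mul_nonneg h0 hκ0
    have b : β * κ ≤ β := mul_le_of_le_one_right h0 hκ1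
    simp only [hm]
    split_ifs <;> constructor <;> linarith
  have hcount (a : K) : ∑ x, (if a + x = 0 then (0 : ℝ) else 1) = Fintype.card K - 1 := by
    have (x : K) : (if a + x = 0 then (0 : ℝ) else 1) = 1 - if x = -a then 1 else 0 := by
      simp only [add_eq_zero_iff_neg_eq, eq_comm (a := -a)]
      split_ifs <;> simp
    simp [this, Finset.sum_sub_distrib]
  have hmean (j : Fin n) : ∑ x, mixPMF K β x * f j x = 0 := by
    rw [sum_mixPMF_mul]
    simp only [hf, Finset.sum_sub_distrib, hcount, hm, add_zero, Finset.sum_const,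
      Finset.card_univ, nsmul_eq_mul, hκ]
    field_simp
    ring
  have hvar := (moments_sum_pi (mixPMF K β) (sum_mixPMF K β) n f hmean).2
  have hsum (v : Fin n → K) : ∑ j, f j (v j)
      = (hammingNorm (c + v) : ℝ) - ((1 - β) * hammingNorm c + β * κ * n) := by
    simp only [hf, hm, Finset.sum_sub_distrib, hammingNorm_cast, Finset.sum_add_distrib,
      Finset.mul_sum, Pi.add_apply]
    simp
    ring
  simp only [hsum] at hvar
  rw [hvar]
  have hle (j : Fin n) : ∑ x, mixPMF K β x * f j x ^ 2 ≤ 1 := by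
    rw [← sum_mixPMF K β]
    refine Finset.sum_le_sum fun x _ => mul_le_of_le_one_right (mixPMF_nonneg K h0 h1 x) ?_
    obtain ⟨a, b⟩ := hmem j
    rw [sq_le_one_iff_abs_le_one, abs_le]
    simp only [hf]
    split_ifs <;> constructor <;> linarith
  calc _ ≤ ∑ _j : Fin n, (1 : ℝ) := Finset.sum_le_sum fun j _ => hle j
    _ = n := by simp

/-- Some shift of `C` has mean squared weight deviation at most the length. -/
lemma exists_shift_sum_sq_le (K : Type) [Field K] [Fintype K] [DecidableEq K]
    {β : ℝ} (h0 : 0 ≤ β) (h1 : β ≤ 1) {n : ℕ} (C : Finset (Fin n → K)) (w : ℕ)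
    (hw : ∀ c ∈ C, hammingNorm c = w) :
    ∃ v : Fin n → K, ∑ c ∈ C, ((hammingNorm (c + v) : ℝ) -
      ((1 - β) * w + β * (((Fintype.card K : ℝ) - 1) / Fintype.card K) * n)) ^ 2
        ≤ (n * C.card : ℝ) := by
  by_contra! hcon
  set P : (Fin n → K) → ℝ := fun v => ∏ j, mixPMF K β (v j)
  have hP0 (v) : 0 ≤ P v := Finset.prod_nonneg fun j _ => mixPMF_nonneg K h0 h1 _
  have hP1 : ∑ v, P v = 1 := sum_prod_eq_one _ (sum_mixPMF K β) n
  set μ : ℝ := (1 - β) * w + β * (((Fintype.card K : ℝ) - 1) / Fintype.card K) * n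
  have hup : ∑ v, P v * ∑ c ∈ C, ((hammingNorm (c + v) : ℝ) - μ) ^ 2 ≤ n * C.card := by
    simp only [Finset.mul_sum]
    rw [Finset.sum_comm]
    calc _ ≤ ∑ c ∈ C, (n : ℝ) := Finset.sum_le_sum fun c hc => by
          have := variance_hammingNorm_add_le K h0 h1 c
          rwa [hw c hc] at this
      _ = _ := by simp [mul_comm]
  obtain ⟨v, -, hv⟩ : ∃ v ∈ Finset.univ, 0 < P v := by
    by_contra! h
    have := Finset.sum_nonpos h
    linarith
  have hlow : ∑ v, P v * (n * C.card : ℝ)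
      < ∑ v, P v * ∑ c ∈ C, ((hammingNorm (c + v) : ℝ) - μ) ^ 2 :=
    Finset.sum_lt_sum (fun u _ => mul_le_mul_of_nonneg_left (hcon u).le (hP0 u))
      ⟨v, Finset.mem_univ _, mul_lt_mul_of_pos_left (hcon v) hv⟩
  rw [← Finset.sum_mul, hP1] at hlow
  linarith

lemma hammingNorm_le_length {K : Type} [Field K] [DecidableEq K] {n : ℕ} (c : Fin n → K) :
    hammingNorm c ≤ n := by
  simpa using hammingNorm_le_card_fintype (x := c)

/-- A constant-weight code has a large subcode which, after a shift, is a constant-weight code of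
weight close to a prescribed value between its own weight and `(q - 1) / q * n`. -/
lemma exists_reweighted_code (K : Type) [Field K] [Fintype K] [DecidableEq K]
    {β : ℝ} (h0 : 0 ≤ β) (h1 : β ≤ 1) {n : ℕ} (C : Set (Fin n → K)) (hC : C.Nonempty) (w : ℕ)
    (hw : ∀ c ∈ C, hammingNorm c = w) :
    ∃ (C' : Set (Fin n → K)) (w' : ℕ), C'.Nonempty ∧ (∀ c ∈ C', hammingNorm c = w') ∧
      |(w' : ℝ) - ((1 - β) * w + β * (((Fintype.card K : ℝ) - 1) / Fintype.card K) * n)|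
        ≤ √(2 * (n + 1)) ∧
      C.ncard ≤ 2 * (n + 1) * C'.ncard ∧
      (1 < C'.ncard → minDist C ≤ minDist C') := by
  classical
  obtain ⟨D, rfl⟩ : ∃ D : Finset (Fin n → K), C = D := ⟨C.toFinset, by simp⟩
  obtain ⟨v, hv⟩ := exists_shift_sum_sq_le K h0 h1 D w hw
  set μ : ℝ := (1 - β) * w + β * (((Fintype.card K : ℝ) - 1) / Fintype.card K) * n
  set t : ℝ := √(2 * (n + 1))
  have ht : t ^ 2 = 2 * (n + 1) := Real.sq_sqrt (by positivity)
  have ht0 : 0 ≤ t := Real.sqrt_nonneg _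
  set G := D.filter fun c => |(hammingNorm (c + v) : ℝ) - μ| ≤ t
  have hcard := Finset.card_filter_add_card_filter_not (s := D)
    (fun c => |(hammingNorm (c + v) : ℝ) - μ| ≤ t)
  set B := D.filter fun c => ¬ |(hammingNorm (c + v) : ℝ) - μ| ≤ t
  have hbad : (2 * (n + 1) : ℝ) * B.card ≤ n * D.card := by
    calc (2 * (n + 1) : ℝ) * B.card = ∑ c ∈ B, t ^ 2 := by simp [ht, mul_comm]
      _ ≤ ∑ c ∈ B, ((hammingNorm (c + v) : ℝ) - μ) ^ 2 := by
          refine Finset.sum_le_sum fun c hc => ?_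
          rw [← sq_abs ((hammingNorm (c + v) : ℝ) - μ)]
          exact pow_le_pow_left₀ ht0 (not_le.1 (Finset.mem_filter.1 hc).2).le 2
      _ ≤ ∑ c ∈ D, ((hammingNorm (c + v) : ℝ) - μ) ^ 2 :=
          Finset.sum_le_sum_of_subset_of_nonneg (Finset.filter_subset _ _)
            fun _ _ _ => sq_nonneg _
      _ ≤ _ := hv
  have hhalf : D.card ≤ 2 * G.card := by
    have hbad' : 2 * (n + 1) * B.card ≤ n * D.card := by exact_mod_cast hbad
    have : B.card * 2 ≤ D.card := by
      by_contra! h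
      nlinarith [Nat.zero_le n]
    change G.card + B.card = D.card at hcard
    omega
  obtain ⟨w', -, hfib⟩ : ∃ w' ∈ Finset.range (n + 1),
      G.card ≤ (n + 1) * (G.filter fun c => hammingNorm (c + v) = w').card := by
    by_contra! h
    have hs := Finset.card_eq_sum_card_fiberwise (s := G) (t := Finset.range (n + 1))
      (f := fun c => hammingNorm (c + v)) (fun c _ => by
        simpa using Nat.lt_succ_of_le (hammingNorm_le_length (c + v)))
    have := Finset.sum_lt_sum_of_nonempty (by simp) h
    rw [← Finset.mul_sum, ← hs] at this
    simp at this
  set H := G.filter fun c => hammingNorm (c + v) = w'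
  have hHD (c) (hc : c ∈ H) : c ∈ D := (Finset.mem_filter.1 (Finset.mem_filter.1 hc).1).1
  have hinj : Function.Injective fun c : Fin n → K => c + v := add_left_injective v
  have hle : D.card ≤ 2 * (n + 1) * H.card := by nlinarith
  have hHpos : H.Nonempty := by
    rw [← Finset.card_pos]
    have : 0 < D.card := Finset.card_pos.2 (by exact_mod_cast hC)
    by_contra! h
    simp_all
  have hncard : ((fun c => c + v) '' (H : Set (Fin n → K))).ncard = H.card := by
    rw [Set.ncard_image_of_injective _ hinj, Set.ncard_coe_finset]
  refine ⟨(fun c => c + v) '' H, w', (Finset.coe_nonempty.2 hHpos).image _, ?_, ?_, ?_, ?_⟩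
  · rintro _ ⟨c, hc, rfl⟩
    exact (Finset.mem_filter.1 hc).2
  · obtain ⟨c, hc⟩ := hHpos
    rw [← (Finset.mem_filter.1 hc).2]
    exact (Finset.mem_filter.1 (Finset.mem_filter.1 hc).1).2
  · rwa [hncard, Set.ncard_coe_finset]
  · intro h
    obtain ⟨a, ha, b, hb, hab⟩ := Set.one_lt_ncard_iff_nontrivial.1 h
    refine le_csInf ⟨_, a, ha, b, hb, hab, rfl⟩ ?_
    rintro d ⟨_, ⟨x, hx, rfl⟩, _, ⟨y, hy, rfl⟩, hxy, rfl⟩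
    refine Nat.sInf_le ⟨x, hHD x hx, y, hHD y hy, fun e => hxy (by rw [e]), ?_⟩
    simp [hammingDist]

lemma minDist_le_length {K : Type} [DecidableEq K] {n : ℕ} (C : Set (Fin n → K)) :
    minDist C ≤ n := by
  rcases Set.eq_empty_or_nonempty
    {d : ℕ | ∃ c ∈ C, ∃ c' ∈ C, c ≠ c' ∧ hammingDist c c' = d} with h | ⟨d, hd⟩
  · simp [minDist, h]
  · refine (Nat.sInf_le hd).trans ?_
    obtain ⟨c, -, c', -, -, rfl⟩ := hd
    simpa using hammingDist_le_card_fintype (x := c) (y := c')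

lemma relDist_mem_Icc {K : Type} [DecidableEq K] {n : ℕ} (C : Set (Fin n → K)) :
    (minDist C : ℝ) / n ∈ Set.Icc (0 : ℝ) 1 :=
  ⟨by positivity, div_le_one_of_le₀ (by exact_mod_cast minDist_le_length C) (by positivity)⟩

lemma rate_mem_Icc {K : Type} [Fintype K] [Nontrivial K] {n : ℕ}
    (C : Set (Fin n → K)) (hC : C.Nonempty) :
    Real.logb (Fintype.card K) C.ncard / n ∈ Set.Icc (0 : ℝ) 1 := by
  have hq : (1 : ℝ) < Fintype.card K := by exact_mod_cast Fintype.one_lt_card (α := K)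
  have hpos : 0 < C.ncard := (Set.ncard_pos (Set.toFinite C)).2 hC
  have hle : C.ncard ≤ Fintype.card K ^ n := by
    have := Set.ncard_le_card C
    simpa using this
  refine ⟨div_nonneg (Real.logb_nonneg hq (by exact_mod_cast hpos)) (by positivity),
    div_le_one_of_le₀ ?_ (by positivity)⟩
  rw [Real.logb_le_iff_le_rpow hq (by exact_mod_cast hpos), Real.rpow_natCast]
  exact_mod_cast hle

lemma tendsto_sqrt_two_mul_succ_div :
    Tendsto (fun n : ℕ => √(2 * ((n : ℝ) + 1)) / n) atTop (nhds 0) := by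
  have hlim : Tendsto (fun n : ℕ => 2 / √(n : ℝ)) atTop (nhds 0) :=
    Tendsto.const_div_atTop (Real.tendsto_sqrt_atTop.comp tendsto_natCast_atTop_atTop) 2
  refine squeeze_zero' (Eventually.of_forall fun n => by positivity) ?_ hlim
  filter_upwards [eventually_ge_atTop 1] with n hn
  have hn' : (1 : ℝ) ≤ n := by exact_mod_cast hn
  have hs : 0 < √(n : ℝ) := Real.sqrt_pos.2 (by linarith)
  have hsq : √(n : ℝ) * √(n : ℝ) = n := Real.mul_self_sqrt (by linarith)
  have h : √(2 * ((n : ℝ) + 1)) ≤ 2 * √n := by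
    rw [Real.sqrt_le_left (by positivity)]
    nlinarith
  rw [div_le_div_iff₀ (by linarith) hs]
  nlinarith

/-- Passing to a subcode of index at most `2 (n + 1)` costs at most `O(√n)` in the logarithm. -/
lemma logb_le_of_le_mul {q : ℝ} (hq : 1 < q) {n M M' : ℕ} (hM : 0 < M) (hM' : 0 < M')
    (h : M ≤ 2 * (n + 1) * M') :
    Real.logb q M ≤ 2 / Real.log q * √(2 * ((n : ℝ) + 1)) + Real.logb q M' := by
  have hlog : 0 < Real.log q := Real.log_pos hq
  have h' : (M : ℝ) ≤ (2 * (n + 1)) * M' := by exact_mod_cast h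
  have hM0 : (0 : ℝ) < M := by exact_mod_cast hM
  have hM0' : (0 : ℝ) < M' := by exact_mod_cast hM'
  have hs : 0 < √(2 * ((n : ℝ) + 1)) := Real.sqrt_pos.2 (by positivity)
  have h1 : Real.log (2 * ((n : ℝ) + 1)) ≤ 2 * √(2 * ((n : ℝ) + 1)) := by
    have h2 := Real.log_le_self hs.le
    rw [Real.log_sqrt (by positivity)] at h2
    linarith
  calc Real.logb q M ≤ Real.logb q ((2 * (n + 1)) * M') :=
        Real.logb_le_logb_of_le hq hM0 h'
    _ = Real.log (2 * (n + 1)) / Real.log q + Real.logb q M' := by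
        rw [Real.logb_mul (by positivity) hM0'.ne', Real.logb]
    _ ≤ (2 * √(2 * ((n : ℝ) + 1))) / Real.log q + Real.logb q M' := by gcongr
    _ = _ := by ring

lemma isBoundedUnder_of_mem_Icc {u : ℕ → ℝ} (h : ∀ i, u i ∈ Set.Icc (0 : ℝ) 1) :
    IsBoundedUnder (· ≤ ·) atTop u ∧ IsBoundedUnder (· ≥ ·) atTop u :=
  ⟨isBoundedUnder_of ⟨1, fun i => (h i).2⟩, isBoundedUnder_of ⟨0, fun i => (h i).1⟩⟩

/-- Theorem: for every fixed `δ ∈ [0,(q-1)/q]`, the mapping `ω ↦ R_opt(δ,ω)` is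
non-decreasing on the interval `[0,(q-1)/q]`. -/
theorem RoptCW_monotone
    (K : Type) [Field K] [Fintype K] [DecidableEq K]
    (q : ℕ) (hq : Fintype.card K = q)
    (δ : ℝ) (hδ : δ ∈ Set.Icc (0:ℝ) (((q:ℝ) - 1) / q)) :
    MonotoneOn (fun ω => RoptCW K q δ ω) (Set.Icc (0:ℝ) (((q:ℝ) - 1) / q)) := by
  subst hq
  set κ : ℝ := ((Fintype.card K : ℝ) - 1) / Fintype.card K
  have hq1 : (1 : ℝ) < Fintype.card K := by exact_mod_cast Fintype.one_lt_card (α := K)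
  intro ω₁ hω₁ ω₂ hω₂ hle
  have hnonneg : 0 ≤ RoptCW K (Fintype.card K) δ ω₂ := by
    refine Real.sSup_nonneg ?_
    rintro R ⟨N, C, w, -, hne, -, -, -, rfl⟩
    exact le_limsup_of_frequently_le
      (Frequently.of_forall fun i => (rate_mem_Icc (C i) (hne i)).1)
      (isBoundedUnder_of_mem_Icc fun i => rate_mem_Icc (C i) (hne i)).1
  rcases hle.eq_or_lt with rfl | hlt
  · exact le_rfl
  refine Real.sSup_le ?_ hnonneg
  rintro R ⟨N, C, w, hN, hne, hw, hlim, hδle, rfl⟩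
  refine le_of_forall_lt fun a ha => ?_
  rcases lt_or_ge a 0 with ha0 | ha0
  · exact ha0.trans_le hnonneg
  obtain ⟨b, hab, hb⟩ := exists_between ha
  obtain ⟨a', haa', ha'b⟩ := exists_between hab
  refine haa'.trans_le ?_
  have hκpos : 0 < κ - ω₁ := by linarith [hω₂.2]
  set β : ℝ := (ω₂ - ω₁) / (κ - ω₁) with hβ
  have hβ0 : 0 ≤ β := div_nonneg (by linarith) hκpos.le
  have hβ1 : β ≤ 1 := by rw [hβ, div_le_one hκpos]; linarith [hω₂.2]
  have hβω : (1 - β) * ω₁ + β * κ = ω₂ := by rw [hβ]; field_simp; ring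
  have hfreq := frequently_lt_of_lt_limsup
    (isBoundedUnder_of_mem_Icc fun i => rate_mem_Icc (C i) (hne i)).2.isCoboundedUnder_le hb
  obtain ⟨φ, hφ, hφb⟩ := extraction_of_frequently_atTop hfreq
  choose C' w' hne' hw' hww' hcard hdist using fun i =>
    exists_reweighted_code K hβ0 hβ1 (C (φ i)) (hne (φ i)) (w (φ i)) (hw (φ i))
  have hNφ : StrictMono fun i => N (φ i) := hN.comp hφ
  have hNpos : ∀ᶠ i in atTop, 0 < N (φ i) := hNφ.tendsto_atTop.eventually_gt_atTop 0
  have hsqrt := tendsto_sqrt_two_mul_succ_div.comp hNφ.tendsto_atTop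
  have hrate : ∀ᶠ i in atTop,
      a' < Real.logb (Fintype.card K) (C' i).ncard / (N (φ i)) := by
    have hsmall := (hsqrt.const_mul (2 / Real.log (Fintype.card K))).eventually_lt_const
      (show _ < b - a' by rw [mul_zero]; linarith)
    filter_upwards [hsmall, hNpos] with i hi hpos
    have hpos' : (0 : ℝ) < N (φ i) := by exact_mod_cast hpos
    have h1 := logb_le_of_le_mul hq1 ((Set.ncard_pos (Set.toFinite _)).2 (hne (φ i)))
      ((Set.ncard_pos (Set.toFinite _)).2 (hne' i)) (hcard i)
    have h2 := div_le_div_of_nonneg_right h1 hpos'.le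
    rw [add_div, mul_div_assoc] at h2
    have h3 := hφb i
    simp only [Function.comp_apply] at hi
    linarith
  have hdist' : ∀ᶠ i in atTop, minDist (C (φ i)) ≤ minDist (C' i) := by
    filter_upwards [hrate] with i hi
    refine hdist i ?_
    by_contra! h
    have h1 : (C' i).ncard = 1 := le_antisymm h ((Set.ncard_pos (Set.toFinite _)).2 (hne' i))
    rw [h1] at hi
    simp at hi
    linarith
  have hmem : limsup (fun i => Real.logb (Fintype.card K) (C' i).ncard / (N (φ i))) atTop ≤
      RoptCW K (Fintype.card K) δ ω₂ := by
    refine le_csSup ⟨1, ?_⟩ ⟨fun i => N (φ i), C', w', hNφ, hne', hw', ?_, ?_, rfl⟩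
    · rintro R ⟨N, C, w, -, hne, -, -, -, rfl⟩
      have hI := fun i => rate_mem_Icc (C i) (hne i)
      exact limsup_le_of_le (isBoundedUnder_of_mem_Icc hI).2.isCoboundedUnder_le
        (Eventually.of_forall fun i => (hI i).2)
    · have hmain : Tendsto (fun i => (1 - β) * ((w (φ i) : ℝ) / N (φ i)) + β * κ) atTop
          (nhds ω₂) := by
        rw [← hβω]
        exact ((hlim.comp hφ.tendsto_atTop).const_mul _).add_const _
      have hdiff : Tendsto (fun i => (w' i : ℝ) / N (φ i) -
          ((1 - β) * ((w (φ i) : ℝ) / N (φ i)) + β * κ)) atTop (nhds 0) := by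
        refine squeeze_zero_norm' ?_ hsqrt
        filter_upwards [hNpos] with i hpos
        have hpos' : (0 : ℝ) < N (φ i) := by exact_mod_cast hpos
        have : (w' i : ℝ) / N (φ i) - ((1 - β) * ((w (φ i) : ℝ) / N (φ i)) + β * κ)
            = ((w' i : ℝ) - ((1 - β) * w (φ i) + β * κ * N (φ i))) / N (φ i) := by
          field_simp
        rw [this, Real.norm_eq_abs, abs_div, abs_of_pos hpos']
        exact div_le_div_of_nonneg_right (hww' i) hpos'.le
      simpa using hdiff.add hmain
    · refine le_of_forall_lt_imp_le_of_dense fun d hd => ?_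
      have hev := eventually_lt_of_lt_liminf (hd.trans_le hδle)
        (isBoundedUnder_of_mem_Icc fun i => relDist_mem_Icc (C i)).2
      refine le_liminf_of_le
        (isBoundedUnder_of_mem_Icc fun i => relDist_mem_Icc (C' i)).1.isCoboundedUnder_ge ?_
      filter_upwards [hφ.tendsto_atTop.eventually hev, hdist'] with i h1 h2
      refine h1.le.trans ?_
      gcongr
  refine le_trans ?_ hmem
  exact le_limsup_of_frequently_le (hrate.mono fun i hi => hi.le).frequently
    (isBoundedUnder_of_mem_Icc fun i => rate_mem_Icc (C' i) (hne' i)).1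
end
end
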